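/- arXiv:2405.20999 — 3 statements merged into one kernel-verified Lean document; each statement's English description precedes it below -/
import Mathlib

section
/- Let F : ℝ² → ℝ be entire. Then for every real λ ≠ 0 there exists a unique real-analytic vector field u : ℝ³ → ℝ³ solving the Cauchy problem curl u = λ·u on all of ℝ³ with Cauchy datum u(x, y, 0) = (∂₁F(x, y), ∂₂F(x, y), 0) for all (x, y) ∈ ℝ²; uniqueness holds in the class of real-analytic vector fields on ℝ³. -/
/-- Partial derivative `∂₁` of a function on `ℝ³`. -/
noncomputable def pdx (g : ℝ × ℝ × ℝ → ℝ) (x : ℝ × ℝ × ℝ) : ℝ := fderiv ℝ g x (1, 0, 0)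

/-- Partial derivative `∂₂` of a function on `ℝ³`. -/
noncomputable def pdy (g : ℝ × ℝ × ℝ → ℝ) (x : ℝ × ℝ × ℝ) : ℝ := fderiv ℝ g x (0, 1, 0)

/-- Partial derivative `∂₃` of a function on `ℝ³`. -/
noncomputable def pdz (g : ℝ × ℝ × ℝ → ℝ) (x : ℝ × ℝ × ℝ) : ℝ := fderiv ℝ g x (0, 0, 1)

/-- `curl u = (∂₂u₃ − ∂₃u₂, ∂₃u₁ − ∂₁u₃, ∂₁u₂ − ∂₂u₁)`. -/
noncomputable def curl3 (u : ℝ × ℝ × ℝ → ℝ × ℝ × ℝ) (x : ℝ × ℝ × ℝ) : ℝ × ℝ × ℝ :=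
  (pdy (fun y => (u y).2.2) x - pdz (fun y => (u y).2.1) x,
   pdz (fun y => (u y).1) x - pdx (fun y => (u y).2.2) x,
   pdx (fun y => (u y).2.1) x - pdy (fun y => (u y).1) x)

/-- Partial derivative `∂₁` of a function on `ℝ²`. -/
noncomputable def pd2x (F : ℝ × ℝ → ℝ) (p : ℝ × ℝ) : ℝ := fderiv ℝ F p (1, 0)

/-- Partial derivative `∂₂` of a function on `ℝ²`. -/
noncomputable def pd2y (F : ℝ × ℝ → ℝ) (p : ℝ × ℝ) : ℝ := fderiv ℝ F p (0, 1)

/-- A function `F : ℝ² → ℝ` is entire if it extends to a holomorphic function on `ℂ²`. -/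
def IsEntire (F : ℝ × ℝ → ℝ) : Prop :=
  ∃ G : ℂ × ℂ → ℂ, Differentiable ℂ G ∧ ∀ x y : ℝ, G (↑x, ↑y) = ↑(F (x, y))

/-- Cauchy's formula for the Taylor coefficients of an entire function, on the unit circle. -/
theorem iteratedDeriv_div_factorial_eq_circleIntegral {f : ℂ → ℂ} (hf : Differentiable ℂ f)
    (n : ℕ) : iteratedDeriv n f 0 / (n.factorial : ℂ) =
      (2 * ↑Real.pi * Complex.I)⁻¹ • ∮ z in C(0, 1), (z⁻¹) ^ n • z⁻¹ • f z := by
  have h1 := (hf.analyticAt 0).hasFPowerSeriesAt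
  have h2 := (hf.hasFPowerSeriesOnBall 0 (R := 1) one_pos).hasFPowerSeriesAt
  have h3 := congrArg (fun p : FormalMultilinearSeries ℂ ℂ ℂ => p n (fun _ => (1 : ℂ)))
    (h1.eq_formalMultilinearSeries h2)
  simp only [NNReal.coe_one, cauchyPowerSeries_apply] at h3
  simpa [FormalMultilinearSeries.ofScalars_apply_eq] using h3

theorem exists_norm_le_of_norm_le {G : ℂ × ℂ → ℂ} (hG : Continuous G) (R S : ℝ) :
    ∃ M, ∀ x y, ‖x‖ ≤ R → ‖y‖ ≤ S → ‖G (x, y)‖ ≤ M := by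
  obtain ⟨M, hM⟩ := ((isCompact_closedBall (0 : ℂ) R).prod
    (isCompact_closedBall (0 : ℂ) S)).exists_bound_of_continuousOn hG.continuousOn
  exact ⟨M, fun x y hx hy => hM (x, y) (by simp [hx, hy])⟩

/-- A path integral depends holomorphically on a parameter if its integrand does. -/
theorem differentiable_intervalIntegral_of_param {G : ℂ × ℂ → ℂ} (hG : Differentiable ℂ G)
    {k γ : ℝ → ℂ} (hk : Continuous k) (hγ : Continuous γ) {R : ℝ} (hR : ∀ θ, ‖γ θ‖ ≤ R)
    (a b : ℝ) : Differentiable ℂ fun y => ∫ θ in a..b, k θ * G (γ θ, y) := by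
  intro y₀
  have hGy : ∀ z, Differentiable ℂ fun y => G (z, y) := fun z =>
    hG.comp ((differentiable_const z).prodMk differentiable_id)
  have hGc : Continuous G := hG.continuous
  obtain ⟨M, hM⟩ := exists_norm_le_of_norm_le hGc R (‖y₀‖ + 2)
  have hmeas : Measurable fun θ : ℝ => deriv (fun y => G (γ θ, y)) y₀ := by
    have h := measurable_deriv_with_param (𝕜 := ℂ) (α := ℝ)
      (f := fun θ y => G (γ θ, y)) (by unfold Function.uncurry; fun_prop)
    exact h.comp (measurable_id.prodMk measurable_const)
  have key := intervalIntegral.hasDerivAt_integral_of_dominated_loc_of_deriv_le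
    (μ := MeasureTheory.volume) (a := a) (b := b)
    (F := fun y θ => k θ * G (γ θ, y))
    (F' := fun y θ => k θ * deriv (fun y => G (γ θ, y)) y)
    (bound := fun θ => ‖k θ‖ * (M / 1))
    (Metric.ball_mem_nhds y₀ one_pos) ?_ ?_ ?_ ?_ ?_ ?_
  · exact key.2.differentiableAt
  · refine Filter.Eventually.of_forall fun y => Continuous.aestronglyMeasurable ?_
    fun_prop
  · refine Continuous.intervalIntegrable ?_ _ _
    fun_prop
  · exact (hk.measurable.mul hmeas).aestronglyMeasurable
  · refine Filter.Eventually.of_forall fun θ _ y hy => ?_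
    rw [norm_mul]
    gcongr
    refine Complex.norm_deriv_le_of_forall_mem_sphere_norm_le one_pos (hGy _).diffContOnCl ?_
    intro w hw
    refine hM _ _ (hR θ) ?_
    have h1 : ‖w - y‖ = 1 := by simpa [dist_eq_norm] using hw
    have h2 : ‖y - y₀‖ < 1 := by simpa [dist_eq_norm] using hy
    calc ‖w‖ = ‖(w - y) + (y - y₀) + y₀‖ := by congr 1; ring
      _ ≤ ‖w - y‖ + ‖y - y₀‖ + ‖y₀‖ := norm_add₃_le
      _ ≤ ‖y₀‖ + 2 := by linarith
  · refine Continuous.intervalIntegrable ?_ _ _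
    fun_prop
  · exact Filter.Eventually.of_forall fun θ _ y hy => (hGy _ y).hasDerivAt.const_mul _

/-- A circle integral depends holomorphically on a parameter if its integrand does. -/
theorem differentiable_circleIntegral_of_param {G : ℂ × ℂ → ℂ} (hG : Differentiable ℂ G)
    {k : ℂ → ℂ} (hk : ContinuousOn k (Metric.sphere 0 1)) :
    Differentiable ℂ fun y => ∮ z in C(0, 1), k z * G (z, y) := by
  have hkc : Continuous fun θ : ℝ => k (circleMap 0 1 θ) :=
    hk.comp_continuous (continuous_circleMap 0 1) fun θ => circleMap_mem_sphere _ zero_le_one θ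
  have hdc : Continuous fun θ : ℝ => deriv (circleMap 0 1) θ := by
    simp only [deriv_circleMap]; fun_prop
  have h := differentiable_intervalIntegral_of_param hG (hdc.mul hkc) (continuous_circleMap 0 1)
    (R := 1) (fun θ => by simp) 0 (2 * Real.pi)
  simpa only [circleIntegral, smul_eq_mul, mul_assoc, Pi.mul_apply] using h

theorem differentiable_iteratedDeriv_fst {G : ℂ × ℂ → ℂ} (hG : Differentiable ℂ G) (m : ℕ) :
    Differentiable ℂ fun y => iteratedDeriv m (fun x => G (x, y)) 0 := by
  have hGx : ∀ y, Differentiable ℂ fun x => G (x, y) := fun y =>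
    hG.comp (differentiable_id.prodMk (differentiable_const y))
  have h : (fun y => iteratedDeriv m (fun x => G (x, y)) 0) = fun y => (m.factorial : ℂ) *
      ((2 * ↑Real.pi * Complex.I)⁻¹ * ∮ z in C(0, 1), ((z⁻¹) ^ m * z⁻¹) * G (z, y)) := by
    funext y
    have h1 := iteratedDeriv_div_factorial_eq_circleIntegral (hGx y) m
    have h2 : (m.factorial : ℂ) ≠ 0 := by exact_mod_cast m.factorial_ne_zero
    rw [div_eq_iff h2] at h1
    rw [h1]
    simp only [smul_eq_mul, mul_assoc]
    ring
  rw [h]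
  refine ((differentiable_circleIntegral_of_param hG ?_).const_mul _).const_mul _
  have : ContinuousOn (fun z : ℂ => z⁻¹) (Metric.sphere 0 1) := by
    refine continuousOn_inv₀.mono fun z hz => ?_
    rintro rfl
    simp at hz
  exact (this.pow m).mul this

/-- Doubly indexed Taylor coefficients at the origin of a function on `ℂ²`. -/
noncomputable def taylorCoeff₂ (G : ℂ × ℂ → ℂ) (m n : ℕ) : ℂ :=
  (n.factorial : ℂ)⁻¹ * ((m.factorial : ℂ)⁻¹ *
    iteratedDeriv n (fun y => iteratedDeriv m (fun x => G (x, y)) 0) 0)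

theorem exists_norm_taylorCoeff₂_mul_pow_le {G : ℂ × ℂ → ℂ} (hG : Differentiable ℂ G) {R : ℝ}
    (hR : 0 < R) : ∃ M, ∀ m n, ‖taylorCoeff₂ G m n‖ * R ^ (m + n) ≤ M := by
  have hGx : ∀ y, Differentiable ℂ fun x => G (x, y) := fun y =>
    hG.comp (differentiable_id.prodMk (differentiable_const y))
  obtain ⟨M, hM⟩ := exists_norm_le_of_norm_le hG.continuous R R
  refine ⟨M, fun m n => ?_⟩
  have h1 : ∀ y ∈ Metric.sphere (0 : ℂ) R,
      ‖iteratedDeriv m (fun x => G (x, y)) 0‖ ≤ m.factorial * M / R ^ m := by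
    intro y hy
    refine Complex.norm_iteratedDeriv_le_of_forall_mem_sphere_norm_le m hR
      (hGx y).diffContOnCl fun x hx => ?_
    exact hM x y (by simpa using hx.le) (by simpa using hy.le)
  have h2 := Complex.norm_iteratedDeriv_le_of_forall_mem_sphere_norm_le n hR
      (differentiable_iteratedDeriv_fst hG m).diffContOnCl h1
  have hm : (0 : ℝ) < m.factorial := by exact_mod_cast m.factorial_pos
  have hn : (0 : ℝ) < n.factorial := by exact_mod_cast n.factorial_pos
  rw [taylorCoeff₂, norm_mul, norm_mul, norm_inv, norm_inv, Complex.norm_natCast,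
    Complex.norm_natCast]
  calc _ ≤ (n.factorial : ℝ)⁻¹ * ((m.factorial : ℝ)⁻¹ *
        (n.factorial * (m.factorial * M / R ^ m) / R ^ n)) * R ^ (m + n) := by gcongr
    _ = M := by
      rw [pow_add]
      field_simp

theorem summable_of_mul_pow_le {E : Type*} [NormedAddCommGroup E] [CompleteSpace E]
    {f : ℕ × ℕ → E} {M : ℝ} (h : ∀ m n, ‖f (m, n)‖ * 2 ^ (m + n) ≤ M) : Summable f := by
  have hg : Summable fun n : ℕ => (1 / 2 : ℝ) ^ n := summable_geometric_two
  have hs := (hg.mul_of_nonneg hg (fun _ => by positivity) fun _ => by positivity).mul_left M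
  refine Summable.of_norm_bounded hs fun ⟨m, n⟩ => ?_
  have := h m n
  rw [← le_div_iff₀ (by positivity)] at this
  refine this.trans_eq ?_
  simp only [one_div, inv_pow]
  rw [pow_add]
  field_simp

theorem summable_taylorCoeff₂ {G : ℂ × ℂ → ℂ} (hG : Differentiable ℂ G) (x y : ℂ) :
    Summable fun p : ℕ × ℕ => taylorCoeff₂ G p.1 p.2 * x ^ p.1 * y ^ p.2 := by
  have hR : 0 < 2 * (‖x‖ + ‖y‖ + 1) := by positivity
  obtain ⟨M, hM⟩ := exists_norm_taylorCoeff₂_mul_pow_le hG hR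
  refine summable_of_mul_pow_le (M := M) fun m n => ?_
  refine le_trans ?_ (hM m n)
  rw [norm_mul, norm_mul, norm_pow, norm_pow, mul_pow]
  have h1 : ‖x‖ ^ m ≤ (‖x‖ + ‖y‖ + 1) ^ m := by
    gcongr; linarith [norm_nonneg y]
  have h2 : ‖y‖ ^ n ≤ (‖x‖ + ‖y‖ + 1) ^ n := by
    gcongr; linarith [norm_nonneg x]
  calc ‖taylorCoeff₂ G m n‖ * ‖x‖ ^ m * ‖y‖ ^ n * 2 ^ (m + n)
      ≤ ‖taylorCoeff₂ G m n‖ * (‖x‖ + ‖y‖ + 1) ^ m * (‖x‖ + ‖y‖ + 1) ^ n * 2 ^ (m + n) := by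
        gcongr
    _ = _ := by rw [pow_add (‖x‖ + ‖y‖ + 1)]; ring

theorem hasSum_taylorCoeff₂ {G : ℂ × ℂ → ℂ} (hG : Differentiable ℂ G) (x y : ℂ) :
    HasSum (fun p : ℕ × ℕ => taylorCoeff₂ G p.1 p.2 * x ^ p.1 * y ^ p.2) (G (x, y)) := by
  have hGx : Differentiable ℂ fun x => G (x, y) :=
    hG.comp (differentiable_id.prodMk (differentiable_const y))
  have hs := (summable_taylorCoeff₂ hG x y).hasSum
  have h1 : ∀ m : ℕ, HasSum (fun n => taylorCoeff₂ G m n * x ^ m * y ^ n)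
      ((m.factorial : ℂ)⁻¹ • (x - 0) ^ m • iteratedDeriv m (fun x => G (x, y)) 0) := by
    intro m
    have h := (Complex.hasSum_taylorSeries_of_entire (differentiable_iteratedDeriv_fst hG m)
      0 y).mul_left ((m.factorial : ℂ)⁻¹ * x ^ m)
    simp only [smul_eq_mul, sub_zero] at h ⊢
    rw [mul_assoc] at h
    refine h.congr_fun fun n => ?_
    rw [taylorCoeff₂]
    ring
  have h2 := hs.prod_fiberwise h1
  rwa [h2.unique (Complex.hasSum_taylorSeries_of_entire hGx 0 x)] at hs

/-- The restriction to `ℝ²` of an entire function has an everywhere convergent real Taylor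
expansion. -/
theorem exists_real_taylorCoeff {F : ℝ × ℝ → ℝ} {G : ℂ × ℂ → ℂ} (hG : Differentiable ℂ G)
    (hGF : ∀ x y : ℝ, G (↑x, ↑y) = ↑(F (x, y))) :
    ∃ a : ℕ → ℕ → ℝ, (∀ R : ℝ, 0 < R → ∃ M, ∀ m n, |a m n| * R ^ (m + n) ≤ M) ∧
      ∀ x y : ℝ, HasSum (fun p : ℕ × ℕ => a p.1 p.2 * x ^ p.1 * y ^ p.2) (F (x, y)) := by
  refine ⟨fun m n => (taylorCoeff₂ G m n).re, fun R hR => ?_, fun x y => ?_⟩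
  · obtain ⟨M, hM⟩ := exists_norm_taylorCoeff₂_mul_pow_le hG hR
    refine ⟨M, fun m n => le_trans ?_ (hM m n)⟩
    gcongr
    exact Complex.abs_re_le_norm _
  · have h := Complex.hasSum_re (hasSum_taylorCoeff₂ hG x y)
    rw [hGF, Complex.ofReal_re] at h
    convert h using 2 with p
    rw [← Complex.ofReal_pow, ← Complex.ofReal_pow, Complex.re_mul_ofReal, Complex.re_mul_ofReal]

theorem hasDerivAt_slice_x {g : ℝ × ℝ × ℝ → ℝ} {x y z : ℝ}
    (hg : DifferentiableAt ℝ g (x, y, z)) :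
    HasDerivAt (fun t => g (t, y, z)) (pdx g (x, y, z)) x :=
  HasFDerivAt.comp_hasDerivAt (f := fun t => (t, y, z)) x hg.hasFDerivAt
    ((hasDerivAt_id x).prodMk (hasDerivAt_const x (y, z)))

theorem hasDerivAt_slice_y {g : ℝ × ℝ × ℝ → ℝ} {x y z : ℝ}
    (hg : DifferentiableAt ℝ g (x, y, z)) :
    HasDerivAt (fun t => g (x, t, z)) (pdy g (x, y, z)) y :=
  HasFDerivAt.comp_hasDerivAt (f := fun t => (x, t, z)) y hg.hasFDerivAt
    ((hasDerivAt_const y x).prodMk ((hasDerivAt_id y).prodMk (hasDerivAt_const y z)))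

theorem hasDerivAt_slice_z {g : ℝ × ℝ × ℝ → ℝ} {x y z : ℝ}
    (hg : DifferentiableAt ℝ g (x, y, z)) :
    HasDerivAt (fun t => g (x, y, t)) (pdz g (x, y, z)) z :=
  HasFDerivAt.comp_hasDerivAt (f := fun t => (x, y, t)) z hg.hasFDerivAt
    ((hasDerivAt_const z x).prodMk ((hasDerivAt_const z y).prodMk (hasDerivAt_id z)))

/-- A trivariate power series with infinite radius of convergence, in terms of its
coefficients. -/
def IsEntireCoeff (c : ℕ → ℕ → ℕ → ℝ) : Prop :=
  ∀ R : ℝ, 1 ≤ R → ∃ M, ∀ p q r, |c p q r| * R ^ (p + q + r) ≤ M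

/-- The sum of a trivariate power series. -/
noncomputable def powerSum (c : ℕ → ℕ → ℕ → ℝ) (v : ℝ × ℝ × ℝ) : ℝ :=
  ∑' α : ℕ × ℕ × ℕ, c α.1 α.2.1 α.2.2 * v.1 ^ α.1 * v.2.1 ^ α.2.1 * v.2.2 ^ α.2.2

/-- Coefficients of `∂₁`. -/
def coeffDx (c : ℕ → ℕ → ℕ → ℝ) (p q r : ℕ) : ℝ := (p + 1) * c (p + 1) q r

/-- Coefficients of `∂₂`. -/
def coeffDy (c : ℕ → ℕ → ℕ → ℝ) (p q r : ℕ) : ℝ := (q + 1) * c p (q + 1) r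

/-- Coefficients of `∂₃`. -/
def coeffDz (c : ℕ → ℕ → ℕ → ℝ) (p q r : ℕ) : ℝ := (r + 1) * c p q (r + 1)

namespace IsEntireCoeff

variable {c d : ℕ → ℕ → ℕ → ℝ}

theorem add (hc : IsEntireCoeff c) (hd : IsEntireCoeff d) :
    IsEntireCoeff fun p q r => c p q r + d p q r := by
  intro R hR
  obtain ⟨M, hM⟩ := hc R hR
  obtain ⟨N, hN⟩ := hd R hR
  refine ⟨M + N, fun p q r => ?_⟩
  have h : |c p q r + d p q r| * R ^ (p + q + r) ≤ (|c p q r| + |d p q r|) * R ^ (p + q + r) := by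
    gcongr
    exact abs_add_le _ _
  linarith [hM p q r, hN p q r]

theorem const_mul (hc : IsEntireCoeff c) (k : ℝ) : IsEntireCoeff fun p q r => k * c p q r := by
  intro R hR
  obtain ⟨M, hM⟩ := hc R hR
  refine ⟨|k| * M, fun p q r => ?_⟩
  rw [abs_mul, mul_assoc]
  gcongr
  exact hM p q r

theorem succ_mul_pow_le {R : ℝ} (hR : 1 ≤ R) {k n : ℕ} (hk : k ≤ n) :
    ((k : ℝ) + 1) * R ^ n ≤ (2 * R) ^ (n + 1) := by
  have h1 : ((k : ℝ) + 1) ≤ 2 ^ (n + 1) := by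
    have : k + 1 < 2 ^ (k + 1) := Nat.lt_two_pow_self
    calc ((k : ℝ) + 1) ≤ 2 ^ (k + 1) := by exact_mod_cast this.le
      _ ≤ 2 ^ (n + 1) := by gcongr; norm_num
  have h2 : R ^ n ≤ R ^ (n + 1) := pow_le_pow_right₀ hR (by lia)
  rw [mul_pow]
  gcongr

theorem dx (hc : IsEntireCoeff c) : IsEntireCoeff (coeffDx c) := by
  intro R hR
  obtain ⟨M, hM⟩ := hc (2 * R) (by linarith)
  refine ⟨M, fun p q r => le_trans ?_ (hM (p + 1) q r)⟩
  have h := succ_mul_pow_le hR (k := p) (n := p + q + r) (by lia)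
  rw [coeffDx, abs_mul, abs_of_nonneg (by positivity), mul_comm (_ + 1 : ℝ), mul_assoc,
    show p + 1 + q + r = p + q + r + 1 by ring]
  gcongr

theorem dy (hc : IsEntireCoeff c) : IsEntireCoeff (coeffDy c) := by
  intro R hR
  obtain ⟨M, hM⟩ := hc (2 * R) (by linarith)
  refine ⟨M, fun p q r => le_trans ?_ (hM p (q + 1) r)⟩
  have h := succ_mul_pow_le hR (k := q) (n := p + q + r) (by lia)
  rw [coeffDy, abs_mul, abs_of_nonneg (by positivity), mul_comm (_ + 1 : ℝ), mul_assoc,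
    show p + (q + 1) + r = p + q + r + 1 by ring]
  gcongr

theorem dz (hc : IsEntireCoeff c) : IsEntireCoeff (coeffDz c) := by
  intro R hR
  obtain ⟨M, hM⟩ := hc (2 * R) (by linarith)
  refine ⟨M, fun p q r => le_trans ?_ (hM p q (r + 1))⟩
  have h := succ_mul_pow_le hR (k := r) (n := p + q + r) (by lia)
  rw [coeffDz, abs_mul, abs_of_nonneg (by positivity), mul_comm (_ + 1 : ℝ), mul_assoc,
    show p + q + (r + 1) = p + q + r + 1 by ring]
  gcongr

theorem summable_abs_mul_pow (hc : IsEntireCoeff c) {R : ℝ} (hR : 1 ≤ R) :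
    Summable fun α : ℕ × ℕ × ℕ => |c α.1 α.2.1 α.2.2| * R ^ (α.1 + α.2.1 + α.2.2) := by
  obtain ⟨M, hM⟩ := hc (2 * R) (by linarith)
  have hg : Summable fun n : ℕ => (1 / 2 : ℝ) ^ n := summable_geometric_two
  have hg2 := hg.mul_of_nonneg hg (fun _ => by positivity) fun _ => by positivity
  have hs := (hg.mul_of_nonneg hg2 (fun _ => by positivity) fun _ => by positivity).mul_left M
  refine Summable.of_nonneg_of_le (fun α => by positivity) (fun ⟨p, q, r⟩ => ?_) hs
  have := hM p q r
  rw [mul_pow, mul_left_comm, mul_comm, ← le_div_iff₀ (by positivity)] at this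
  refine this.trans_eq ?_
  simp only [one_div, inv_pow]
  rw [pow_add, pow_add]
  field_simp

theorem abs_term_le (c : ℕ → ℕ → ℕ → ℝ) {R x y z : ℝ} (hx : |x| ≤ R) (hy : |y| ≤ R)
    (hz : |z| ≤ R) (p q r : ℕ) :
    |c p q r * x ^ p * y ^ q * z ^ r| ≤ |c p q r| * R ^ (p + q + r) := by
  have hR : 0 ≤ R := (abs_nonneg x).trans hx
  rw [abs_mul, abs_mul, abs_mul, abs_pow, abs_pow, abs_pow, pow_add, pow_add, ← mul_assoc,
    ← mul_assoc]
  gcongr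

theorem summable_abs (hc : IsEntireCoeff c) (x y z : ℝ) :
    Summable fun α : ℕ × ℕ × ℕ =>
      |c α.1 α.2.1 α.2.2 * x ^ α.1 * y ^ α.2.1 * z ^ α.2.2| := by
  have h : 1 ≤ 1 + |x| + |y| + |z| := by
    linarith [abs_nonneg x, abs_nonneg y, abs_nonneg z]
  refine Summable.of_nonneg_of_le (fun _ => abs_nonneg _) (fun α => ?_)
    (hc.summable_abs_mul_pow h)
  exact abs_term_le c (by linarith [abs_nonneg y, abs_nonneg z])
    (by linarith [abs_nonneg x, abs_nonneg z]) (by linarith [abs_nonneg x, abs_nonneg y]) _ _ _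

theorem summable (hc : IsEntireCoeff c) (v : ℝ × ℝ × ℝ) :
    Summable fun α : ℕ × ℕ × ℕ =>
      c α.1 α.2.1 α.2.2 * v.1 ^ α.1 * v.2.1 ^ α.2.1 * v.2.2 ^ α.2.2 :=
  (hc.summable_abs _ _ _).of_abs

end IsEntireCoeff

/-- The multilinear form `x ^ i * y ^ (j - i) * z ^ (n - j)` of degree `n` on `ℝ³`. -/
noncomputable def monomialForm (n i j : ℕ) :
    ContinuousMultilinearMap ℝ (fun _ : Fin n => ℝ × ℝ × ℝ) ℝ :=
  (ContinuousMultilinearMap.mkPiAlgebra ℝ (Fin n) ℝ).compContinuousLinearMap fun k =>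
    if (k : ℕ) < i then ContinuousLinearMap.fst ℝ ℝ (ℝ × ℝ)
    else if (k : ℕ) < j then
      (ContinuousLinearMap.fst ℝ ℝ ℝ).comp (ContinuousLinearMap.snd ℝ ℝ (ℝ × ℝ))
    else (ContinuousLinearMap.snd ℝ ℝ ℝ).comp (ContinuousLinearMap.snd ℝ ℝ (ℝ × ℝ))

theorem norm_monomialForm_le (n i j : ℕ) : ‖monomialForm n i j‖ ≤ 1 := by
  refine (ContinuousMultilinearMap.norm_compContinuousLinearMap_le _ _).trans ?_
  rw [ContinuousMultilinearMap.norm_mkPiAlgebra, one_mul]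
  refine Finset.prod_le_one (fun _ _ => norm_nonneg _) fun k _ => ?_
  have h1 := ContinuousLinearMap.norm_fst_le ℝ ℝ (ℝ × ℝ)
  have h2 := ContinuousLinearMap.norm_snd_le ℝ ℝ (ℝ × ℝ)
  have h3 := ContinuousLinearMap.norm_fst_le ℝ ℝ ℝ
  have h4 := ContinuousLinearMap.norm_snd_le ℝ ℝ ℝ
  split_ifs
  · exact h1
  · exact (ContinuousLinearMap.opNorm_comp_le _ _).trans
      (mul_le_one₀ h3 (norm_nonneg _) h2)
  · exact (ContinuousLinearMap.opNorm_comp_le _ _).trans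
      (mul_le_one₀ h4 (norm_nonneg _) h2)

theorem monomialForm_apply (p q r : ℕ) (v : ℝ × ℝ × ℝ) :
    monomialForm (p + q + r) p (p + q) (fun _ => v) = v.1 ^ p * v.2.1 ^ q * v.2.2 ^ r := by
  have h : ∀ k : Fin (p + q + r), (if (k : ℕ) < p then ContinuousLinearMap.fst ℝ ℝ (ℝ × ℝ)
      else if (k : ℕ) < p + q then
        (ContinuousLinearMap.fst ℝ ℝ ℝ).comp (ContinuousLinearMap.snd ℝ ℝ (ℝ × ℝ))
      else (ContinuousLinearMap.snd ℝ ℝ ℝ).comp (ContinuousLinearMap.snd ℝ ℝ (ℝ × ℝ))) v =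
      if (k : ℕ) < p then v.1 else if (k : ℕ) < p + q then v.2.1 else v.2.2 := by
    intro k
    split_ifs <;> rfl
  simp only [monomialForm, ContinuousMultilinearMap.compContinuousLinearMap_apply,
    ContinuousMultilinearMap.mkPiAlgebra_apply, h]
  rw [Fin.prod_univ_eq_prod_range
    (fun k => if k < p then v.1 else if k < p + q then v.2.1 else v.2.2),
    Finset.prod_range_add, Finset.prod_range_add]
  congr 1
  · congr 1
    · rw [Finset.prod_congr rfl (g := fun _ => v.1)]
      · simp
      · intro k hk
        simp [Finset.mem_range.1 hk]
    · rw [Finset.prod_congr rfl (g := fun _ => v.2.1)]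
      · simp
      · intro k hk
        simp [Finset.mem_range.1 hk]
  · rw [Finset.prod_congr rfl (g := fun _ => v.2.2)]
    · simp
    · intro k _
      rw [if_neg (by lia), if_neg (by lia)]

/-- The finite set of trivariate exponents of total degree `n`. -/
def exponentsOfDegree (n : ℕ) : Finset (ℕ × ℕ × ℕ) :=
  (Finset.range (n + 1) ×ˢ Finset.range (n + 1) ×ˢ Finset.range (n + 1)).filter
    fun α => α.1 + α.2.1 + α.2.2 = n

theorem mem_exponentsOfDegree {n : ℕ} {α : ℕ × ℕ × ℕ} :
    α ∈ exponentsOfDegree n ↔ α.1 + α.2.1 + α.2.2 = n := by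
  simp only [exponentsOfDegree, Finset.mem_filter, Finset.mem_product, Finset.mem_range]
  lia

theorem HasSum.sum_exponentsOfDegree {f : ℕ × ℕ × ℕ → ℝ} {a : ℝ} (hf : HasSum f a) :
    HasSum (fun n => ∑ α ∈ exponentsOfDegree n, f α) a := by
  refine (hf.tsum_fiberwise fun α => α.1 + α.2.1 + α.2.2).congr_fun fun n => ?_
  have h : (fun α : ℕ × ℕ × ℕ => α.1 + α.2.1 + α.2.2) ⁻¹' {n} = ↑(exponentsOfDegree n) := by
    ext α
    simp [mem_exponentsOfDegree]
  rw [h, Finset.tsum_subtype']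

/-- A trivariate power series, as a formal multilinear series. -/
noncomputable def powerSeriesOfCoeff (c : ℕ → ℕ → ℕ → ℝ) :
    FormalMultilinearSeries ℝ (ℝ × ℝ × ℝ) ℝ := fun n =>
  ∑ α ∈ exponentsOfDegree n, c α.1 α.2.1 α.2.2 • monomialForm n α.1 (α.1 + α.2.1)

namespace IsEntireCoeff

variable {c d : ℕ → ℕ → ℕ → ℝ}

theorem radius_powerSeriesOfCoeff (hc : IsEntireCoeff c) :
    (powerSeriesOfCoeff c).radius = ⊤ := by
  refine FormalMultilinearSeries.radius_eq_top_of_summable_norm _ fun R => ?_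
  have hR : (1 : ℝ) ≤ R + 1 := by simp
  refine Summable.of_nonneg_of_le (fun n => by positivity) (fun n => ?_)
    (hc.summable_abs_mul_pow hR).hasSum.sum_exponentsOfDegree.summable
  rw [powerSeriesOfCoeff]
  refine (mul_le_mul_of_nonneg_right (norm_sum_le _ _) (by positivity)).trans ?_
  rw [Finset.sum_mul]
  refine Finset.sum_le_sum fun α hα => ?_
  rw [mem_exponentsOfDegree] at hα
  rw [norm_smul, Real.norm_eq_abs, hα]
  have := norm_monomialForm_le n α.1 (α.1 + α.2.1)
  have h2 : (R : ℝ) ^ n ≤ (R + 1) ^ n := by gcongr; linarith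
  calc _ ≤ |c α.1 α.2.1 α.2.2| * 1 * (R : ℝ) ^ n := by gcongr
    _ ≤ _ := by rw [mul_one]; gcongr

theorem hasFPowerSeriesOnBall (hc : IsEntireCoeff c) :
    HasFPowerSeriesOnBall (powerSum c) (powerSeriesOfCoeff c) 0 ⊤ where
  r_le := hc.radius_powerSeriesOfCoeff.ge
  r_pos := ENNReal.zero_lt_top
  hasSum := by
    intro v _
    rw [zero_add]
    refine (hc.summable v).hasSum.sum_exponentsOfDegree.congr_fun fun n => ?_
    rw [powerSeriesOfCoeff, sum_apply]
    refine Finset.sum_congr rfl fun α hα => ?_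
    rw [mem_exponentsOfDegree] at hα
    subst hα
    rw [smul_apply, monomialForm_apply, smul_eq_mul, mul_assoc,
      mul_assoc, mul_assoc]

theorem analyticAt_powerSum (hc : IsEntireCoeff c) (v : ℝ × ℝ × ℝ) :
    AnalyticAt ℝ (powerSum c) v :=
  hc.hasFPowerSeriesOnBall.analyticAt_of_mem (by simp)

end IsEntireCoeff

/-- Termwise differentiation of an everywhere absolutely convergent power series in one
variable, whose terms are indexed by an arbitrary type. -/
theorem hasDerivAt_tsum_mul_pow {ι : Type*} {b : ι → ℝ} {e : ι → ℕ}
    (h : ∀ R : ℝ, 1 ≤ R → Summable fun i => |b i| * R ^ e i) (t : ℝ) :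
    HasDerivAt (fun s => ∑' i, b i * s ^ e i) (∑' i, b i * (e i * t ^ (e i - 1))) t := by
  have hR : 1 ≤ |t| + 1 := by simp
  refine hasDerivAt_tsum_of_isPreconnected (t := Metric.ball 0 (|t| + 1)) (y₀ := 0)
    (g' := fun i s => b i * (e i * s ^ (e i - 1)))
    (h (2 * (|t| + 1)) (by linarith)) Metric.isOpen_ball
    (convex_ball _ _).isPreconnected (fun i s _ => (hasDerivAt_pow _ _).const_mul _) ?_
    (by simp; positivity) ?_ (by simp)
  · intro i s hs
    rw [mem_ball_zero_iff, Real.norm_eq_abs] at hs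
    rw [Real.norm_eq_abs, abs_mul, abs_mul, abs_pow, Nat.abs_cast]
    gcongr
    rw [mul_pow]
    have h1 : (e i : ℝ) ≤ 2 ^ e i := by exact_mod_cast Nat.lt_two_pow_self.le
    have h2 : |s| ^ (e i - 1) ≤ (|t| + 1) ^ e i := by
      calc |s| ^ (e i - 1) ≤ (|t| + 1) ^ (e i - 1) := by gcongr
        _ ≤ _ := pow_le_pow_right₀ hR (by lia)
    gcongr
  · refine Summable.of_norm_bounded (h 1 le_rfl) fun i => ?_
    rw [Real.norm_eq_abs, abs_mul, abs_pow, abs_zero]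
    gcongr
    norm_num

namespace IsEntireCoeff

variable {c d : ℕ → ℕ → ℕ → ℝ}

theorem pdx_powerSum (hc : IsEntireCoeff c) (v : ℝ × ℝ × ℝ) :
    pdx (powerSum c) v = powerSum (coeffDx c) v := by
  obtain ⟨x, y, z⟩ := v
  have h1 : HasDerivAt (fun t => powerSum c (t, y, z)) (pdx (powerSum c) (x, y, z)) x :=
    hasDerivAt_slice_x (hc.analyticAt_powerSum (x, y, z)).differentiableAt
  have h2 := hasDerivAt_tsum_mul_pow (b := fun α : ℕ × ℕ × ℕ =>
    c α.1 α.2.1 α.2.2 * y ^ α.2.1 * z ^ α.2.2) (e := fun α => α.1) (fun R hR =>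
      (hc.summable_abs R y z).congr fun α => by
        simp only [abs_mul, abs_pow, abs_of_pos (zero_lt_one.trans_le hR)]; ring) x
  have h3 : (fun t => powerSum c (t, y, z)) = fun s => ∑' α : ℕ × ℕ × ℕ,
      c α.1 α.2.1 α.2.2 * y ^ α.2.1 * z ^ α.2.2 * s ^ α.1 := by
    funext t
    exact tsum_congr fun α => by ring
  rw [h3] at h1
  rw [h1.unique h2, powerSum, ← Function.Injective.tsum_eq
    (g := fun α : ℕ × ℕ × ℕ => (α.1 + 1, α.2.1, α.2.2))]
  · refine tsum_congr fun α => ?_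
    simp only [coeffDx, Nat.add_sub_cancel]
    push_cast
    ring
  · rintro ⟨a, b, c⟩ ⟨a', b', c'⟩ h
    simpa using h
  · rintro ⟨_ | p, q, r⟩ h
    · simp at h
    · exact ⟨(p, q, r), rfl⟩

theorem pdy_powerSum (hc : IsEntireCoeff c) (v : ℝ × ℝ × ℝ) :
    pdy (powerSum c) v = powerSum (coeffDy c) v := by
  obtain ⟨x, y, z⟩ := v
  have h1 : HasDerivAt (fun t => powerSum c (x, t, z)) (pdy (powerSum c) (x, y, z)) y :=
    hasDerivAt_slice_y (hc.analyticAt_powerSum (x, y, z)).differentiableAt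
  have h2 := hasDerivAt_tsum_mul_pow (b := fun α : ℕ × ℕ × ℕ =>
    c α.1 α.2.1 α.2.2 * x ^ α.1 * z ^ α.2.2) (e := fun α => α.2.1) (fun R hR =>
      (hc.summable_abs x R z).congr fun α => by
        simp only [abs_mul, abs_pow, abs_of_pos (zero_lt_one.trans_le hR)]; ring) y
  have h3 : (fun t => powerSum c (x, t, z)) = fun s => ∑' α : ℕ × ℕ × ℕ,
      c α.1 α.2.1 α.2.2 * x ^ α.1 * z ^ α.2.2 * s ^ α.2.1 := by
    funext t
    exact tsum_congr fun α => by ring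
  rw [h3] at h1
  rw [h1.unique h2, powerSum, ← Function.Injective.tsum_eq
    (g := fun α : ℕ × ℕ × ℕ => (α.1, α.2.1 + 1, α.2.2))]
  · refine tsum_congr fun α => ?_
    simp only [coeffDy, Nat.add_sub_cancel]
    push_cast
    ring
  · rintro ⟨a, b, c⟩ ⟨a', b', c'⟩ h
    simpa using h
  · rintro ⟨p, _ | q, r⟩ h
    · simp at h
    · exact ⟨(p, q, r), rfl⟩

theorem pdz_powerSum (hc : IsEntireCoeff c) (v : ℝ × ℝ × ℝ) :
    pdz (powerSum c) v = powerSum (coeffDz c) v := by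
  obtain ⟨x, y, z⟩ := v
  have h1 : HasDerivAt (fun t => powerSum c (x, y, t)) (pdz (powerSum c) (x, y, z)) z :=
    hasDerivAt_slice_z (hc.analyticAt_powerSum (x, y, z)).differentiableAt
  have h2 := hasDerivAt_tsum_mul_pow (b := fun α : ℕ × ℕ × ℕ =>
    c α.1 α.2.1 α.2.2 * x ^ α.1 * y ^ α.2.1) (e := fun α => α.2.2) (fun R hR =>
      (hc.summable_abs x y R).congr fun α => by
        simp only [abs_mul, abs_pow, abs_of_pos (zero_lt_one.trans_le hR)]) z
  rw [show (fun t => powerSum c (x, y, t)) = fun s => ∑' α : ℕ × ℕ × ℕ,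
    c α.1 α.2.1 α.2.2 * x ^ α.1 * y ^ α.2.1 * s ^ α.2.2 from rfl] at h1
  rw [h1.unique h2, powerSum, ← Function.Injective.tsum_eq
    (g := fun α : ℕ × ℕ × ℕ => (α.1, α.2.1, α.2.2 + 1))]
  · refine tsum_congr fun α => ?_
    simp only [coeffDz, Nat.add_sub_cancel]
    push_cast
    ring
  · rintro ⟨a, b, c⟩ ⟨a', b', c'⟩ h
    simpa using h
  · rintro ⟨p, q, _ | r⟩ h
    · simp at h
    · exact ⟨(p, q, r), rfl⟩

theorem powerSum_sub (hc : IsEntireCoeff c) (hd : IsEntireCoeff d) {e : ℕ → ℕ → ℕ → ℝ} {k : ℝ}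
    (h : ∀ p q r, c p q r - d p q r = k * e p q r) (v : ℝ × ℝ × ℝ) :
    powerSum c v - powerSum d v = k * powerSum e v := by
  rw [powerSum, powerSum, powerSum, ← (hc.summable v).tsum_sub (hd.summable v), ← tsum_mul_left]
  refine tsum_congr fun α => ?_
  rw [← sub_mul, ← sub_mul, ← sub_mul, h]
  ring

end IsEntireCoeff

theorem powerSum_mk_zero (c : ℕ → ℕ → ℕ → ℝ) (x y : ℝ) :
    powerSum c (x, y, 0) = ∑' p : ℕ × ℕ, c p.1 p.2 0 * x ^ p.1 * y ^ p.2 := by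
  rw [powerSum, ← Function.Injective.tsum_eq (g := fun p : ℕ × ℕ => (p.1, p.2, 0))]
  · simp
  · rintro ⟨a, b⟩ ⟨a', b'⟩ h
    simpa using h
  · rintro ⟨p, q, _ | r⟩ h
    · exact ⟨(p, q), rfl⟩
    · simp at h

/-- Coefficients of the solution `w` of the Helmholtz equation `Δw + λ²w = 0` with Cauchy data
`w = 0` and `∂₃w = ∑ a p q x^p y^q` on the plane `z = 0`. The exponent of `z` comes first. -/
noncomputable def helmholtzCoeff (lam : ℝ) (a : ℕ → ℕ → ℝ) : ℕ → ℕ → ℕ → ℝ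
  | 0, _, _ => 0
  | 1, p, q => a p q
  | r + 2, p, q => -((p + 2) * (p + 1) * helmholtzCoeff lam a r (p + 2) q +
      (q + 2) * (q + 1) * helmholtzCoeff lam a r p (q + 2) +
      lam ^ 2 * helmholtzCoeff lam a r p q) / ((r + 1) * (r + 2))

theorem choose_add_two_mul (n r : ℕ) :
    ((n + r + 2).choose (r + 2) : ℝ) * ((r + 1) * (r + 2)) =
      (n + r + 2).choose r * ((n + 1) * (n + 2)) := by
  have h1 := Nat.choose_succ_right_eq (n + r + 2) (r + 1)
  have h2 := Nat.choose_succ_right_eq (n + r + 2) r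
  rw [show n + r + 2 - (r + 1) = n + 1 by lia] at h1
  rw [show n + r + 2 - r = n + 2 by lia] at h2
  have h1' : ((n + r + 2).choose (r + 2) : ℝ) * (r + 2) = (n + r + 2).choose (r + 1) * (n + 1) := by
    exact_mod_cast h1
  have h2' : ((n + r + 2).choose (r + 1) : ℝ) * (r + 1) = (n + r + 2).choose r * (n + 2) := by
    exact_mod_cast h2
  linear_combination (r + 1 : ℝ) * h1' + (n + 1 : ℝ) * h2'

theorem choose_le_choose_add_two (n r : ℕ) :
    (n + r).choose r ≤ (n + r + 2).choose (r + 2) := by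
  have h1 := Nat.choose_succ_succ (n + r) r
  have h2 := Nat.choose_succ_succ (n + r + 1) (r + 1)
  simp only [Nat.succ_eq_add_one] at h1 h2
  rw [h2, h1]
  lia

/-- A bounded weight whose growth absorbs the zeroth order term of the Helmholtz equation. -/
noncomputable def helmholtzWeight (B : ℝ) (r : ℕ) : ℝ := Real.exp (-(B / (r + 1)))

theorem helmholtzWeight_pos (B : ℝ) (r : ℕ) : 0 < helmholtzWeight B r := Real.exp_pos _

theorem helmholtzWeight_le_one {B : ℝ} (hB : 0 ≤ B) (r : ℕ) : helmholtzWeight B r ≤ 1 := by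
  rw [helmholtzWeight, Real.exp_le_one_iff, neg_nonpos]
  positivity

theorem helmholtzWeight_mul_le {B : ℝ} (hB : 0 ≤ B) (r : ℕ) :
    helmholtzWeight B r * ((r + 1) * (r + 2) + B) ≤
      (r + 1) * (r + 2) * helmholtzWeight B (r + 2) := by
  have h1 : helmholtzWeight B (r + 2) =
      helmholtzWeight B r * Real.exp (2 * B / ((r + 1) * (r + 3))) := by
    rw [helmholtzWeight, helmholtzWeight, ← Real.exp_add]
    congr 1
    push_cast
    field_simp
    ring
  have h2 : B / ((r + 1) * (r + 2)) + 1 ≤ Real.exp (2 * B / ((r + 1) * (r + 3))) := by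
    refine le_trans ?_ (Real.add_one_le_exp _)
    gcongr ?_ + 1
    rw [div_le_div_iff₀ (by positivity) (by positivity)]
    have : 0 ≤ B * ((r + 1) * (r + 1)) := by positivity
    nlinarith
  rw [h1]
  calc helmholtzWeight B r * ((r + 1) * (r + 2) + B)
      = (r + 1) * (r + 2) * (helmholtzWeight B r * (B / ((r + 1) * (r + 2)) + 1)) := by
        field_simp
        ring
    _ ≤ _ := by
        have := helmholtzWeight_pos B r
        gcongr

theorem abs_helmholtzCoeff_le {lam : ℝ} {a : ℕ → ℕ → ℝ} {R K : ℝ} (hR : 0 < R) (hK : 0 ≤ K)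
    (ha : ∀ p q, |a p q| * R ^ (p + q) ≤
      K * (2 / R) * helmholtzWeight (lam ^ 2 / (2 / R) ^ 2) 1) (r p q : ℕ) :
    |helmholtzCoeff lam a r p q| * R ^ (p + q) ≤
      K * (2 / R) ^ r * helmholtzWeight (lam ^ 2 / (2 / R) ^ 2) r * (p + q + r).choose r := by
  set T := 2 / R with hT
  have hTpos : 0 < T := by positivity
  set B := lam ^ 2 / T ^ 2 with hB
  have hB0 : 0 ≤ B := by positivity
  have hw := helmholtzWeight_pos B
  induction r using Nat.twoStepInduction generalizing p q with
  | zero => simp only [helmholtzCoeff]; have := hw 0; simp; positivity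
  | one =>
    simp only [helmholtzCoeff, pow_one]
    refine (ha p q).trans (le_mul_of_one_le_right (by have := hw 1; positivity) ?_)
    exact_mod_cast Nat.choose_pos (by lia)
  | more r ih _ =>
    simp only [helmholtzCoeff]
    set n := p + q with hn
    set D := K * T ^ r * helmholtzWeight B r with hD
    have hD0 : 0 ≤ D := by have := hw r; positivity
    have h1 := ih (p + 2) q
    have h2 := ih p (q + 2)
    have h3 := ih p q
    rw [show p + 2 + q + r = n + r + 2 by lia, show p + 2 + q = n + 2 by lia] at h1
    rw [show p + (q + 2) + r = n + r + 2 by lia, show p + (q + 2) = n + 2 by lia] at h2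
    rw [← hn] at h3
    have hc : ((n + r).choose r : ℝ) ≤ (n + r + 2).choose (r + 2) := by
      exact_mod_cast choose_le_choose_add_two n r
    have hid := choose_add_two_mul n r
    set C := ((n + r + 2).choose (r + 2) : ℝ) with hC
    have hC0 : 0 ≤ C := by positivity
    set C' := ((n + r + 2).choose r : ℝ) with hC'
    have hC'0 : 0 ≤ C' := by positivity
    have hpn : (p : ℝ) ≤ n := by exact_mod_cast (by lia : p ≤ n)
    have hqn : (q : ℝ) ≤ n := by exact_mod_cast (by lia : q ≤ n)
    have hRT : (4 : ℝ) = R ^ 2 * T ^ 2 := by rw [hT]; field_simp; norm_num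
    have hBT : lam ^ 2 = B * T ^ 2 := by rw [hB]; field_simp
    have e1 : (p + 2) * (p + 1) * (|helmholtzCoeff lam a r (p + 2) q| * R ^ n) * 4 ≤
        (n + 2) * (n + 1) * (D * C') * T ^ 2 := by
      rw [hRT]
      calc _ = (p + 2) * (p + 1) * (|helmholtzCoeff lam a r (p + 2) q| * R ^ (n + 2)) * T ^ 2 := by
            ring
        _ ≤ _ := by gcongr
    have e2 : (q + 2) * (q + 1) * (|helmholtzCoeff lam a r p (q + 2)| * R ^ n) * 4 ≤
        (n + 2) * (n + 1) * (D * C') * T ^ 2 := by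
      rw [hRT]
      calc _ = (q + 2) * (q + 1) * (|helmholtzCoeff lam a r p (q + 2)| * R ^ (n + 2)) * T ^ 2 := by
            ring
        _ ≤ _ := by gcongr
    have e3 : lam ^ 2 * (|helmholtzCoeff lam a r p q| * R ^ n) ≤ lam ^ 2 * (D * C) := by
      have : D * ((n + r).choose r : ℝ) ≤ D * C := by gcongr
      exact mul_le_mul_of_nonneg_left (h3.trans this) (sq_nonneg lam)
    rw [abs_div, abs_neg, abs_of_pos (by positivity : (0 : ℝ) < (r + 1) * (r + 2)),
      div_mul_eq_mul_div, div_le_iff₀ (by positivity)]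
    have e4 : |(p + 2) * (p + 1) * helmholtzCoeff lam a r (p + 2) q +
        (q + 2) * (q + 1) * helmholtzCoeff lam a r p (q + 2) +
        lam ^ 2 * helmholtzCoeff lam a r p q| ≤
        (p + 2) * (p + 1) * |helmholtzCoeff lam a r (p + 2) q| +
        (q + 2) * (q + 1) * |helmholtzCoeff lam a r p (q + 2)| +
        lam ^ 2 * |helmholtzCoeff lam a r p q| := by
      refine (abs_add_three _ _ _).trans_eq ?_
      rw [abs_mul, abs_mul (_ * _), abs_mul (lam ^ 2), abs_of_nonneg (sq_nonneg lam),
        abs_of_nonneg (by positivity : (0 : ℝ) ≤ (p + 2) * (p + 1)),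
        abs_of_nonneg (by positivity : (0 : ℝ) ≤ (q + 2) * (q + 1))]
    have e5 := helmholtzWeight_mul_le hB0 r
    have e6 : (n + 2) * (n + 1) * (D * C') * T ^ 2 = D * T ^ 2 * (C * ((r + 1) * (r + 2))) := by
      rw [hid]; ring
    calc _ ≤ ((p + 2) * (p + 1) * |helmholtzCoeff lam a r (p + 2) q| +
        (q + 2) * (q + 1) * |helmholtzCoeff lam a r p (q + 2)| +
        lam ^ 2 * |helmholtzCoeff lam a r p q|) * R ^ n := by gcongr
      _ ≤ D * T ^ 2 * (C * ((r + 1) * (r + 2))) + B * T ^ 2 * (D * C) := by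
        rw [← e6, ← hBT]
        have : 0 ≤ (n + 2) * (n + 1) * (D * C') * T ^ 2 := by positivity
        linarith
      _ = K * T ^ (r + 2) * C * (helmholtzWeight B r * ((r + 1) * (r + 2) + B)) := by
        rw [hD]; ring
      _ ≤ K * T ^ (r + 2) * C * ((r + 1) * (r + 2) * helmholtzWeight B (r + 2)) := by gcongr
      _ = _ := by rw [hC, show n + (r + 2) = n + r + 2 by ring]; ring

theorem isEntireCoeff_helmholtzCoeff {a : ℕ → ℕ → ℝ}
    (ha : ∀ R : ℝ, 0 < R → ∃ M, ∀ m n, |a m n| * R ^ (m + n) ≤ M) (lam : ℝ) :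
    IsEntireCoeff fun p q r => helmholtzCoeff lam a r p q := by
  intro R hR
  have hR0 : 0 < 4 * R := by linarith
  obtain ⟨M, hM⟩ := ha (4 * R) hR0
  have hM0 : 0 ≤ M := le_trans (by positivity) (hM 0 0)
  set g := helmholtzWeight (lam ^ 2 / (2 / (4 * R)) ^ 2) with hg
  have hg1 : 0 < g 1 := helmholtzWeight_pos _ _
  set K := M / (2 / (4 * R) * g 1) with hK
  have hK0 : 0 ≤ K := by positivity
  refine ⟨K, fun p q r => ?_⟩
  have h := abs_helmholtzCoeff_le (lam := lam) (a := a) hR0 hK0 (fun p q => by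
    rw [← hg, mul_assoc, hK, div_mul_cancel₀ _ (by positivity)]; exact hM p q) r p q
  rw [← hg] at h
  have h1 : g r ≤ 1 := helmholtzWeight_le_one (by positivity) r
  have h2 : ((p + q + r).choose r : ℝ) ≤ 2 ^ (p + q + r) := by
    exact_mod_cast Nat.choose_le_two_pow _ _
  have h3 : |helmholtzCoeff lam a r p q| * (4 * R) ^ (p + q) ≤
      K * (2 / (4 * R)) ^ r * 1 * 2 ^ (p + q + r) := h.trans (by gcongr)
  have h4 : |helmholtzCoeff lam a r p q| * R ^ (p + q + r) * 2 ^ (p + q) ≤ K := by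
    have h5 : (2 / (4 * R)) ^ r * (2 ^ r * R ^ r) = 1 := by
      rw [← mul_pow, ← mul_pow]
      convert one_pow r using 2
      field_simp
      norm_num
    calc _ = |helmholtzCoeff lam a r p q| * (4 * R) ^ (p + q) * (R ^ r / 2 ^ (p + q)) := by
          rw [show (4 : ℝ) = 2 * 2 by norm_num, mul_pow, mul_pow, pow_add R]
          field_simp
      _ ≤ K * (2 / (4 * R)) ^ r * 1 * 2 ^ (p + q + r) * (R ^ r / 2 ^ (p + q)) := by gcongr
      _ = K * ((2 / (4 * R)) ^ r * (2 ^ r * R ^ r)) := by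
          rw [pow_add 2 (p + q)]
          field_simp
      _ = K := by rw [h5, mul_one]
  refine le_trans (le_mul_of_one_le_right (by positivity) ?_) h4
  exact one_le_pow₀ (by norm_num)

theorem helmholtzCoeff_add_two (lam : ℝ) (a : ℕ → ℕ → ℝ) (p q r : ℕ) :
    (r + 1) * (r + 2) * helmholtzCoeff lam a (r + 2) p q =
      -((p + 2) * (p + 1) * helmholtzCoeff lam a r (p + 2) q +
        (q + 2) * (q + 1) * helmholtzCoeff lam a r p (q + 2) +
        lam ^ 2 * helmholtzCoeff lam a r p q) := by
  rw [helmholtzCoeff]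
  field_simp

theorem curl3_powerSum_eq_smul {c₁ c₂ c₃ : ℕ → ℕ → ℕ → ℝ} {lam : ℝ} (h₁ : IsEntireCoeff c₁)
    (h₂ : IsEntireCoeff c₂) (h₃ : IsEntireCoeff c₃)
    (e₁ : ∀ p q r, coeffDy c₃ p q r - coeffDz c₂ p q r = lam * c₁ p q r)
    (e₂ : ∀ p q r, coeffDz c₁ p q r - coeffDx c₃ p q r = lam * c₂ p q r)
    (e₃ : ∀ p q r, coeffDx c₂ p q r - coeffDy c₁ p q r = lam * c₃ p q r) (v : ℝ × ℝ × ℝ) :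
    curl3 (fun w => (powerSum c₁ w, powerSum c₂ w, powerSum c₃ w)) v =
      lam • (powerSum c₁ v, powerSum c₂ v, powerSum c₃ v) := by
  have h : curl3 (fun w => (powerSum c₁ w, powerSum c₂ w, powerSum c₃ w)) v =
      (pdy (powerSum c₃) v - pdz (powerSum c₂) v, pdz (powerSum c₁) v - pdx (powerSum c₃) v,
        pdx (powerSum c₂) v - pdy (powerSum c₁) v) := rfl
  rw [h, h₃.pdy_powerSum, h₂.pdz_powerSum, h₁.pdz_powerSum, h₃.pdx_powerSum, h₂.pdx_powerSum,
    h₁.pdy_powerSum, h₃.dy.powerSum_sub h₂.dz e₁, h₁.dz.powerSum_sub h₃.dx e₂,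
    h₂.dx.powerSum_sub h₁.dy e₃]
  rfl

/-- If `w` solves the Helmholtz equation `Δw + λ²w = 0` with `w = 0` and `∂₃w = F` on `z = 0`,
then `u = λ curl (w e₃) + curl (curl (w e₃))` solves the Cauchy problem. -/
theorem exists_curl_eq_smul {F : ℝ × ℝ → ℝ} (hF : IsEntire F) (lam : ℝ) :
    ∃ u : ℝ × ℝ × ℝ → ℝ × ℝ × ℝ,
      (∀ x, AnalyticAt ℝ u x) ∧
      (∀ x, curl3 u x = lam • u x) ∧
      (∀ x y : ℝ, u (x, y, 0) = (pd2x F (x, y), pd2y F (x, y), 0)) := by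
  obtain ⟨G, hG, hGF⟩ := hF
  obtain ⟨a, ha, haF⟩ := exists_real_taylorCoeff hG hGF
  set c : ℕ → ℕ → ℕ → ℝ := fun p q r => helmholtzCoeff lam a r p q
  have hc : IsEntireCoeff c := isEntireCoeff_helmholtzCoeff ha lam
  have hc1 := hc.dz.dx.add (hc.dy.const_mul lam)
  have hc2 := hc.dz.dy.add (hc.dx.const_mul (-lam))
  have hc3 := hc.dz.dz.add (hc.const_mul (lam ^ 2))
  have hcF : ∀ x y : ℝ, powerSum (coeffDz c) (x, y, 0) = F (x, y) := by
    intro x y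
    rw [powerSum_mk_zero, ← (haF x y).tsum_eq]
    refine tsum_congr fun p => ?_
    simp [coeffDz, c, helmholtzCoeff]
  have hdF : ∀ p, DifferentiableAt ℝ F p := by
    intro p
    have h : F = fun p : ℝ × ℝ => powerSum (coeffDz c) (p.1, p.2, 0) :=
      funext fun p => (hcF p.1 p.2).symm
    rw [h]
    exact DifferentiableAt.fun_comp' (f := fun p : ℝ × ℝ => (p.1, p.2, (0 : ℝ))) p
      (hc.dz.analyticAt_powerSum _).differentiableAt (by fun_prop)
  refine ⟨fun v => (powerSum _ v, powerSum _ v, powerSum _ v),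
    fun v => (hc1.analyticAt_powerSum v).prod
      ((hc2.analyticAt_powerSum v).prod (hc3.analyticAt_powerSum v)),
    fun v => ?_, fun x y => ?_⟩
  · refine curl3_powerSum_eq_smul hc1 hc2 hc3 (fun p q r => ?_) (fun p q r => ?_)
      (fun p q r => ?_) v
    · simp only [coeffDx, coeffDy, coeffDz]
      push_cast
      ring
    · simp only [coeffDx, coeffDy, coeffDz]
      push_cast
      ring
    · have := helmholtzCoeff_add_two lam a p q r
      simp only [coeffDx, coeffDy, coeffDz, c]
      push_cast
      linear_combination (-lam) * this
  · have hx : powerSum (coeffDx (coeffDz c)) (x, y, 0) = pd2x F (x, y) := by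
      rw [← hc.dz.pdx_powerSum]
      have h1 := hasDerivAt_slice_x (hc.dz.analyticAt_powerSum (x, y, 0)).differentiableAt
      simp only [hcF] at h1
      exact h1.unique (HasFDerivAt.comp_hasDerivAt (f := fun t => (t, y)) x
        (hdF _).hasFDerivAt ((hasDerivAt_id x).prodMk (hasDerivAt_const x y)))
    have hy : powerSum (coeffDy (coeffDz c)) (x, y, 0) = pd2y F (x, y) := by
      rw [← hc.dz.pdy_powerSum]
      have h1 := hasDerivAt_slice_y (hc.dz.analyticAt_powerSum (x, y, 0)).differentiableAt
      simp only [hcF] at h1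
      exact h1.unique (HasFDerivAt.comp_hasDerivAt (f := fun t => (x, t)) y
        (hdF _).hasFDerivAt ((hasDerivAt_const y x).prodMk (hasDerivAt_id y)))
    refine Prod.ext ?_ (Prod.ext ?_ ?_)
    · rw [← hx]
      simp only [powerSum_mk_zero]
      refine tsum_congr fun p => ?_
      simp [coeffDy, c, helmholtzCoeff]
    · rw [← hy]
      simp only [powerSum_mk_zero]
      refine tsum_congr fun p => ?_
      simp [coeffDx, c, helmholtzCoeff]
    · simp only [powerSum_mk_zero]
      refine (tsum_congr fun p => ?_).trans tsum_zero
      simp [coeffDz, c, helmholtzCoeff]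

/-- Directional derivatives of an analytic function commute. -/
theorem fderiv_fderiv_apply_comm {E : Type*} [NormedAddCommGroup E] [NormedSpace ℝ E]
    {g : E → ℝ} (hg : AnalyticOnNhd ℝ g Set.univ) (v e₁ e₂ : E) :
    fderiv ℝ (fun w => fderiv ℝ g w e₁) v e₂ = fderiv ℝ (fun w => fderiv ℝ g w e₂) v e₁ := by
  have hd : DifferentiableAt ℝ (fderiv ℝ g) v := (hg.fderiv v trivial).differentiableAt
  have hs : IsSymmSndFDerivAt ℝ g v :=
    ContDiffAt.isSymmSndFDerivAt (n := 2) (hg v trivial).contDiffAt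
      (by rw [minSmoothness_of_isRCLikeNormedField])
  rw [fderiv_clm_apply hd (differentiableAt_const _),
    fderiv_clm_apply hd (differentiableAt_const _)]
  simpa using hs e₂ e₁

theorem AnalyticOnNhd.fderiv_apply_const {E : Type*} [NormedAddCommGroup E] [NormedSpace ℝ E]
    {g : E → ℝ} (hg : AnalyticOnNhd ℝ g Set.univ) (e : E) :
    AnalyticOnNhd ℝ (fun w => fderiv ℝ g w e) Set.univ := fun v hv =>
  ((ContinuousLinearMap.apply ℝ ℝ e).analyticAt _).comp (hg.fderiv v hv)

/-- An analytic function on `ℝ` all of whose iterated derivatives vanish at `0` is zero. -/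
theorem AnalyticOnNhd.eq_zero_of_iteratedDeriv_eq_zero {f : ℝ → ℝ}
    (hf : AnalyticOnNhd ℝ f Set.univ) (h : ∀ n, iteratedDeriv n f 0 = 0) (t : ℝ) : f t = 0 := by
  have h1 := (hf 0 trivial).hasFPowerSeriesAt
  simp only [h, zero_div] at h1
  have h2 : FormalMultilinearSeries.ofScalars ℝ (fun _ : ℕ => (0 : ℝ)) = 0 := by
    ext n
    simp [FormalMultilinearSeries.ofScalars]
  rw [h2] at h1
  exact hf.eqOn_of_preconnected_of_eventuallyEq (analyticOnNhd_const (v := (0 : ℝ)))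
    isPreconnected_univ trivial h1.eventually_eq_zero trivial

theorem iteratedDeriv_slice_z {g : ℝ × ℝ × ℝ → ℝ} (hg : AnalyticOnNhd ℝ g Set.univ) (x y : ℝ)
    (n : ℕ) : iteratedDeriv n (fun t => g (x, y, t)) = fun t => pdz^[n] g (x, y, t) := by
  induction n generalizing g with
  | zero => simp
  | succ n ih =>
    have h : deriv (fun t => g (x, y, t)) = fun t => pdz g (x, y, t) :=
      funext fun t => (hasDerivAt_slice_z (hg _ trivial).differentiableAt).deriv
    rw [iteratedDeriv_succ', h, Function.iterate_succ_apply]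
    exact ih (hg.fderiv_apply_const _)

/-- Analytic solutions of `curl d = λ d`, `div d = 0` that vanish on the plane `z = 0` have
vanishing normal derivatives of every order there. -/
theorem iterate_pdz_eq_zero {lam : ℝ} (n : ℕ) {d₁ d₂ d₃ : ℝ × ℝ × ℝ → ℝ}
    (ha₁ : AnalyticOnNhd ℝ d₁ Set.univ) (ha₂ : AnalyticOnNhd ℝ d₂ Set.univ)
    (ha₃ : AnalyticOnNhd ℝ d₃ Set.univ)
    (h₁ : pdz d₁ = fun v => pdx d₃ v + lam * d₂ v)
    (h₂ : pdz d₂ = fun v => pdy d₃ v + -lam * d₁ v)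
    (h₃ : pdz d₃ = fun v => -1 * pdx d₁ v + -1 * pdy d₂ v)
    (h0 : ∀ x y, d₁ (x, y, 0) = 0 ∧ d₂ (x, y, 0) = 0 ∧ d₃ (x, y, 0) = 0) (x y : ℝ) :
    pdz^[n] d₁ (x, y, 0) = 0 ∧ pdz^[n] d₂ (x, y, 0) = 0 ∧ pdz^[n] d₃ (x, y, 0) = 0 := by
  induction n generalizing d₁ d₂ d₃ with
  | zero => exact h0 x y
  | succ n ih =>
    have hx : ∀ {g : ℝ × ℝ × ℝ → ℝ}, AnalyticOnNhd ℝ g Set.univ → (∀ x y, g (x, y, 0) = 0) →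
        ∀ x y, pdx g (x, y, 0) = 0 := fun hg hg0 x y => by
      have h := hasDerivAt_slice_x (hg (x, y, 0) trivial).differentiableAt
      simp only [hg0] at h
      exact h.unique (hasDerivAt_const x 0)
    have hy : ∀ {g : ℝ × ℝ × ℝ → ℝ}, AnalyticOnNhd ℝ g Set.univ → (∀ x y, g (x, y, 0) = 0) →
        ∀ x y, pdy g (x, y, 0) = 0 := fun hg hg0 x y => by
      have h := hasDerivAt_slice_y (hg (x, y, 0) trivial).differentiableAt
      simp only [hg0] at h
      exact h.unique (hasDerivAt_const y 0)
    have hz : ∀ {f g : ℝ × ℝ × ℝ → ℝ} (k l : ℝ), AnalyticOnNhd ℝ f Set.univ →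
        AnalyticOnNhd ℝ g Set.univ → ∀ v, pdz (fun w => k * f w + l * g w) v =
          k * pdz f v + l * pdz g v := fun {f g} k l hf hg v => by
      have h := ((hf v trivial).differentiableAt.hasFDerivAt.const_mul k).add
        ((hg v trivial).differentiableAt.hasFDerivAt.const_mul l)
      exact congrArg (fun L => L (0, 0, 1)) h.fderiv
    simp only [Function.iterate_succ_apply]
    refine ih (ha₁.fderiv_apply_const _) (ha₂.fderiv_apply_const _) (ha₃.fderiv_apply_const _)
      ?_ ?_ ?_ fun x y => ⟨?_, ?_, ?_⟩
    · funext v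
      have h := hz 1 lam (ha₃.fderiv_apply_const (1, 0, 0)) ha₂ v
      simp only [one_mul] at h
      conv_lhs => rw [h₁]
      exact h.trans (congrArg (· + _) (fderiv_fderiv_apply_comm ha₃ v _ _))
    · funext v
      have h := hz 1 (-lam) (ha₃.fderiv_apply_const (0, 1, 0)) ha₁ v
      simp only [one_mul] at h
      conv_lhs => rw [h₂]
      exact h.trans (congrArg (· + _) (fderiv_fderiv_apply_comm ha₃ v _ _))
    · funext v
      have h := hz (-1) (-1) (ha₁.fderiv_apply_const (1, 0, 0))
        (ha₂.fderiv_apply_const (0, 1, 0)) v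
      conv_lhs => rw [h₃]
      exact h.trans (congrArg₂ (fun s t => -1 * s + -1 * t)
        (fderiv_fderiv_apply_comm ha₁ v _ _) (fderiv_fderiv_apply_comm ha₂ v _ _))
    · rw [h₁]
      simp [hx ha₃ (fun x y => (h0 x y).2.2), h0]
    · rw [h₂]
      simp [hy ha₃ (fun x y => (h0 x y).2.2), h0]
    · rw [h₃]
      simp [hx ha₁ (fun x y => (h0 x y).1), hy ha₂ (fun x y => (h0 x y).2.1)]

/-- The divergence of a curl vanishes. -/
theorem div_curl3 {d : ℝ × ℝ × ℝ → ℝ × ℝ × ℝ} (hd : AnalyticOnNhd ℝ d Set.univ)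
    (v : ℝ × ℝ × ℝ) :
    pdx (fun w => (curl3 d w).1) v + pdy (fun w => (curl3 d w).2.1) v +
      pdz (fun w => (curl3 d w).2.2) v = 0 := by
  have h1 : AnalyticOnNhd ℝ (fun w => (d w).1) Set.univ := fun v hv =>
    (analyticAt_fst).comp (hd v hv)
  have h2 : AnalyticOnNhd ℝ (fun w => (d w).2.1) Set.univ := fun v hv =>
    (analyticAt_fst).comp ((analyticAt_snd).comp (hd v hv))
  have h3 : AnalyticOnNhd ℝ (fun w => (d w).2.2) Set.univ := fun v hv =>
    (analyticAt_snd).comp ((analyticAt_snd).comp (hd v hv))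
  have hsub : ∀ {f g : ℝ × ℝ × ℝ → ℝ}, AnalyticOnNhd ℝ f Set.univ →
      AnalyticOnNhd ℝ g Set.univ → ∀ e, fderiv ℝ (fun w => f w - g w) v e =
        fderiv ℝ f v e - fderiv ℝ g v e := fun hf hg e => by
    rw [fderiv_fun_sub (hf v trivial).differentiableAt (hg v trivial).differentiableAt, sub_apply]
  simp only [curl3, pdx, pdy, pdz]
  rw [hsub (h3.fderiv_apply_const _) (h2.fderiv_apply_const _),
    hsub (h1.fderiv_apply_const _) (h3.fderiv_apply_const _),
    hsub (h2.fderiv_apply_const _) (h1.fderiv_apply_const _),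
    fderiv_fderiv_apply_comm h3 v (0, 1, 0) (1, 0, 0),
    fderiv_fderiv_apply_comm h2 v (0, 0, 1) (1, 0, 0),
    fderiv_fderiv_apply_comm h1 v (0, 0, 1) (0, 1, 0)]
  ring

/-- An analytic solution of `curl d = λ d` that vanishes on the plane `z = 0` is zero. -/
theorem eq_zero_of_curl3_eq_smul {lam : ℝ} (hlam : lam ≠ 0) {d : ℝ × ℝ × ℝ → ℝ × ℝ × ℝ}
    (hd : AnalyticOnNhd ℝ d Set.univ) (hcurl : ∀ v, curl3 d v = lam • d v)
    (h0 : ∀ x y, d (x, y, 0) = 0) : d = 0 := by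
  have ha₁ : AnalyticOnNhd ℝ (fun w => (d w).1) Set.univ := fun v hv =>
    (analyticAt_fst).comp (hd v hv)
  have ha₂ : AnalyticOnNhd ℝ (fun w => (d w).2.1) Set.univ := fun v hv =>
    (analyticAt_fst).comp ((analyticAt_snd).comp (hd v hv))
  have ha₃ : AnalyticOnNhd ℝ (fun w => (d w).2.2) Set.univ := fun v hv =>
    (analyticAt_snd).comp ((analyticAt_snd).comp (hd v hv))
  have hc1 : ∀ v, (curl3 d v).1 = lam * (d v).1 := fun v => by rw [hcurl]; rfl
  have hc2 : ∀ v, (curl3 d v).2.1 = lam * (d v).2.1 := fun v => by rw [hcurl]; rfl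
  have hc3 : ∀ v, (curl3 d v).2.2 = lam * (d v).2.2 := fun v => by rw [hcurl]; rfl
  have hdiv : ∀ v, pdx (fun w => (d w).1) v + pdy (fun w => (d w).2.1) v +
      pdz (fun w => (d w).2.2) v = 0 := by
    intro v
    have h := div_curl3 hd v
    simp only [hc1, hc2, hc3, pdx, pdy, pdz] at h
    rw [fderiv_const_mul (ha₁ v trivial).differentiableAt,
      fderiv_const_mul (ha₂ v trivial).differentiableAt,
      fderiv_const_mul (ha₃ v trivial).differentiableAt] at h
    simp only [smul_apply, smul_eq_mul, ← mul_add] at h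
    exact (mul_eq_zero.1 h).resolve_left hlam
  have key := fun n => iterate_pdz_eq_zero (lam := lam) n ha₁ ha₂ ha₃
    (funext fun v => by have := hc2 v; simp only [curl3] at this; linarith)
    (funext fun v => by have := hc1 v; simp only [curl3] at this; linarith)
    (funext fun v => by linarith [hdiv v])
    (fun x y => by simp [h0])
  have hslice : ∀ {g : ℝ × ℝ × ℝ → ℝ}, AnalyticOnNhd ℝ g Set.univ →
      (∀ n x y, pdz^[n] g (x, y, 0) = 0) → ∀ x y z, g (x, y, z) = 0 := fun {g} hg hn x y z =>
    AnalyticOnNhd.eq_zero_of_iteratedDeriv_eq_zero (f := fun t => g (x, y, t))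
      (fun t _ => AnalyticAt.fun_comp (f := fun t => (x, y, t)) (hg _ trivial) (by fun_prop))
      (fun n => by rw [iteratedDeriv_slice_z hg]; exact hn n x y) z
  funext ⟨x, y, z⟩
  exact Prod.ext (hslice ha₁ (fun n x y => (key n x y).1) x y z)
    (Prod.ext (hslice ha₂ (fun n x y => (key n x y).2.1) x y z)
      (hslice ha₃ (fun n x y => (key n x y).2.2) x y z))

theorem curl3_sub {u v : ℝ × ℝ × ℝ → ℝ × ℝ × ℝ} {x : ℝ × ℝ × ℝ} (hu : DifferentiableAt ℝ u x)
    (hv : DifferentiableAt ℝ v x) : curl3 (fun y => u y - v y) x = curl3 u x - curl3 v x := by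
  simp only [curl3, pdx, pdy, pdz, Prod.fst_sub, Prod.snd_sub]
  rw [fderiv_fun_sub hu.fst hv.fst, fderiv_fun_sub hu.snd.fst hv.snd.fst,
    fderiv_fun_sub hu.snd.snd hv.snd.snd]
  simp only [sub_apply]
  refine Prod.ext ?_ (Prod.ext ?_ ?_) <;> simp <;> ring

/-- Global Cauchy–Kovalevskaya for the curl operator: for every entire `F : ℝ² → ℝ`
and every `λ ≠ 0` there exists a unique real-analytic vector field `u` on `ℝ³` with
`curl u = λ u` and Cauchy datum `u(x,y,0) = (∂₁F, ∂₂F, 0)`. -/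
theorem statement10 (F : ℝ × ℝ → ℝ) (hF : IsEntire F) (lam : ℝ) (hlam : lam ≠ 0) :
    ∃! u : ℝ × ℝ × ℝ → ℝ × ℝ × ℝ,
      (∀ x, AnalyticAt ℝ u x) ∧
      (∀ x, curl3 u x = lam • u x) ∧
      (∀ x y : ℝ, u (x, y, 0) = (pd2x F (x, y), pd2y F (x, y), 0)) := by
  obtain ⟨u, hu, hcurl, hu0⟩ := exists_curl_eq_smul hF lam
  refine ⟨u, ⟨hu, hcurl, hu0⟩, fun v ⟨hv, hvcurl, hv0⟩ => ?_⟩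
  have h := eq_zero_of_curl3_eq_smul hlam (d := fun x => v x - u x)
    (fun x _ => (hv x).sub (hu x))
    (fun x => by
      rw [curl3_sub (hv x).differentiableAt (hu x).differentiableAt, hvcurl, hcurl, smul_sub])
    (fun x y => by rw [hv0, hu0, sub_self])
  exact funext fun x => sub_eq_zero.1 (congrFun h x)
end

section
/- Let λ ≠ 0 and let u : ℝ³ → ℝ³ be a C¹ vector field with curl u = λ·u that is tangent to the plane {z = 0}, i.e., u₃(x, y, 0) = 0 for all (x, y) ∈ ℝ². Then the planar vector field v(x, y) = (u₁(x, y, 0), u₂(x, y, 0)) satisfies ∂₁v₂ − ∂₂v₁ = 0 on ℝ², and consequently there exists a differentiable function F : ℝ² → ℝ with v = ∇F. In other words, a tangent Cauchy datum for the Beltrami equation on the plane {z = 0} is necessarily a gradient field. -/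
/-- Poincaré lemma in the plane: a differentiable field with vanishing scalar curl is a
gradient. -/
theorem exists_gradient_of_scalar_curl_eq_zero {f g : ℝ × ℝ → ℝ}
    (hf : Differentiable ℝ f) (hg : Differentiable ℝ g)
    (h : ∀ p, pd2x g p - pd2y f p = 0) :
    ∃ F : ℝ × ℝ → ℝ, Differentiable ℝ F ∧ ∀ p, (pd2x F p, pd2y F p) = (f p, g p) := by
  have hω (p : ℝ × ℝ) : HasFDerivAt
      (fun q => f q • ContinuousLinearMap.fst ℝ ℝ ℝ + g q • ContinuousLinearMap.snd ℝ ℝ ℝ)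
      ((fderiv ℝ f p).smulRight (ContinuousLinearMap.fst ℝ ℝ ℝ) +
        (fderiv ℝ g p).smulRight (ContinuousLinearMap.snd ℝ ℝ ℝ)) p :=
    ((hf p).hasFDerivAt.smul_const (ContinuousLinearMap.fst ℝ ℝ ℝ)).add
      ((hg p).hasFDerivAt.smul_const (ContinuousLinearMap.snd ℝ ℝ ℝ))
  have hlin (L : ℝ × ℝ →L[ℝ] ℝ) (v : ℝ × ℝ) : L v = v.1 * L (1, 0) + v.2 * L (0, 1) := by
    rw [← smul_eq_mul, ← smul_eq_mul, ← map_smul, ← map_smul, ← map_add]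
    simp
  obtain ⟨F, hF⟩ := convex_univ.exists_forall_hasFDerivAt_of_fderiv_symmetric isOpen_univ
    (fun p _ => (hω p).differentiableAt.differentiableWithinAt) fun p _ v w => by
      have hp := h p
      simp only [pd2x, pd2y] at hp
      rw [(hω p).fderiv]
      simp only [add_apply, ContinuousLinearMap.smulRight_apply,
        smul_apply, ContinuousLinearMap.coe_fst',
        ContinuousLinearMap.coe_snd', smul_eq_mul]
      rw [hlin (fderiv ℝ f p) v, hlin (fderiv ℝ f p) w, hlin (fderiv ℝ g p) v,
        hlin (fderiv ℝ g p) w]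
      linear_combination (v.1 * w.2 - v.2 * w.1) * hp
  refine ⟨F, fun p => (hF p trivial).differentiableAt, fun p => ?_⟩
  simp [pd2x, pd2y, (hF p trivial).fderiv]

/-- Differentiating the restriction to `{z = 0}` is differentiating along the plane. -/
theorem fderiv_restrict_plane {g : ℝ × ℝ × ℝ → ℝ} {p : ℝ × ℝ}
    (hg : DifferentiableAt ℝ g (p.1, p.2, 0)) (v : ℝ × ℝ) :
    fderiv ℝ (fun q : ℝ × ℝ => g (q.1, q.2, 0)) p v =
      fderiv ℝ g (p.1, p.2, 0) (v.1, v.2, 0) := by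
  have hi : HasFDerivAt (fun q : ℝ × ℝ => (q.1, q.2, (0 : ℝ)))
      ((ContinuousLinearMap.fst ℝ ℝ ℝ).prod ((ContinuousLinearMap.snd ℝ ℝ ℝ).prod 0)) p :=
    hasFDerivAt_fst.prodMk (hasFDerivAt_snd.prodMk (hasFDerivAt_const _ _))
  have hc : HasFDerivAt (fun q : ℝ × ℝ => g (q.1, q.2, 0)) _ p :=
    HasFDerivAt.comp (f := fun q : ℝ × ℝ => (q.1, q.2, (0 : ℝ))) p hg.hasFDerivAt hi
  rw [hc.fderiv]
  rfl

/-- A Beltrami field tangent to the plane `{z = 0}` induces a planar field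
`v = (u₁, u₂)|_{z=0}` with `∂₁v₂ − ∂₂v₁ = 0`, which is therefore a gradient:
`v = ∇F` for some differentiable `F : ℝ² → ℝ`. -/
theorem statement11 (lam : ℝ) (hlam : lam ≠ 0) (u : ℝ × ℝ × ℝ → ℝ × ℝ × ℝ)
    (hu : ContDiff ℝ 1 u) (hcurl : ∀ x, curl3 u x = lam • u x)
    (htan : ∀ x y : ℝ, (u (x, y, 0)).2.2 = 0) :
    (∀ p : ℝ × ℝ,
      pd2x (fun q => (u (q.1, q.2, 0)).2.1) p - pd2y (fun q => (u (q.1, q.2, 0)).1) p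
        = 0) ∧
    ∃ F : ℝ × ℝ → ℝ, Differentiable ℝ F ∧
      ∀ p : ℝ × ℝ,
        (pd2x F p, pd2y F p) = ((u (p.1, p.2, 0)).1, (u (p.1, p.2, 0)).2.1) := by
  have hd : Differentiable ℝ u := hu.differentiable one_ne_zero
  have h₁ : Differentiable ℝ (fun y => (u y).1) := hd.fst
  have h₂ : Differentiable ℝ (fun y => (u y).2.1) := hd.snd.fst
  have hcurl₂ (p : ℝ × ℝ) :
      pd2x (fun q => (u (q.1, q.2, 0)).2.1) p - pd2y (fun q => (u (q.1, q.2, 0)).1) p = 0 := by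
    have hz := congrArg (fun w => w.2.2) (hcurl (p.1, p.2, 0))
    simp only [curl3, pdx, pdy, Prod.smul_snd, htan, smul_zero] at hz
    rw [pd2x, pd2y, fderiv_restrict_plane (g := fun y => (u y).2.1) (h₂ _),
      fderiv_restrict_plane (g := fun y => (u y).1) (h₁ _)]
    exact hz
  have hi : Differentiable ℝ (fun q : ℝ × ℝ => (q.1, q.2, (0 : ℝ))) := by fun_prop
  exact ⟨hcurl₂, exists_gradient_of_scalar_curl_eq_zero (h₁.comp hi) (h₂.comp hi) hcurl₂⟩
end

section
/- For every C^∞ function f : ℝ² → ℝ and every continuous function ε : ℝ² → (0, ∞), there exists an entire function F : ℝ² → ℝ such that |F(x) − f(x)| < ε(x) and |∇F(x) − ∇f(x)| < ε(x) for all x ∈ ℝ². That is, smooth functions on the plane can be approximated, together with their first derivatives, by entire functions with an error decaying as fast as prescribed at infinity. -/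
/-- The gradient `∇f = (∂₁ f, ∂₂ f)` of a function `f : ℝ² → ℝ`. -/
noncomputable def grad2 (f : ℝ × ℝ → ℝ) (x : ℝ × ℝ) : ℝ × ℝ :=
  (fderiv ℝ f x (1, 0), fderiv ℝ f x (0, 1))

/-- The Euclidean norm on `ℝ²`. -/
noncomputable def enorm2 (v : ℝ × ℝ) : ℝ := Real.sqrt (v.1 ^ 2 + v.2 ^ 2)

open MeasureTheory Filter Topology Convolution

/-- The unnormalised Gaussian on the plane. -/
noncomputable def planeGaussian (s : ℝ × ℝ) : ℝ := Real.exp (-(s.1 ^ 2 + s.2 ^ 2))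

lemma continuous_planeGaussian : Continuous planeGaussian := by
  unfold planeGaussian; fun_prop

lemma integrable_planeGaussian : Integrable planeGaussian := by
  have h := integrable_exp_neg_mul_sq (b := 1) one_pos
  refine (h.mul_prod h).congr (Eventually.of_forall fun s => ?_)
  simp only [planeGaussian, ← Real.exp_add]
  ring_nf

lemma integrable_planeGaussian_mul_norm :
    Integrable fun s : ℝ × ℝ => planeGaussian s * ‖s‖ := by
  have h := integrable_exp_neg_mul_sq (b := 1) one_pos
  have h' := (integrable_mul_exp_neg_mul_sq (b := 1) one_pos).norm
  refine ((h'.mul_prod h).add (h.mul_prod h')).mono'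
    (continuous_planeGaussian.mul continuous_norm).aestronglyMeasurable
    (Eventually.of_forall fun s => ?_)
  have hs : ‖s‖ ≤ |s.1| + |s.2| := by
    rw [Prod.norm_def]
    exact max_le_add_of_nonneg (norm_nonneg _) (norm_nonneg _)
  have h0 : 0 ≤ planeGaussian s := (Real.exp_pos _).le
  have he : planeGaussian s = Real.exp (-1 * s.1 ^ 2) * Real.exp (-1 * s.2 ^ 2) := by
    simp only [planeGaussian, ← Real.exp_add]
    ring_nf
  rw [Real.norm_of_nonneg (by positivity)]
  refine (mul_le_mul_of_nonneg_left hs h0).trans (le_of_eq ?_)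
  simp only [Pi.add_apply, norm_mul, Real.norm_eq_abs, Real.abs_exp, he]
  ring

lemma integral_planeGaussian_pos : 0 < ∫ s, planeGaussian s := by
  have h0 : 0 ≤ planeGaussian := fun s => (Real.exp_pos _).le
  rw [integral_pos_iff_support_of_nonneg h0 integrable_planeGaussian]
  have : Function.support planeGaussian = Set.univ := by
    ext s; simp [planeGaussian, Real.exp_ne_zero]
  rw [this]
  exact isOpen_univ.measure_pos _ Set.univ_nonempty

/-- The Gaussian probability density on the plane concentrated at scale `1 / l`. -/
noncomputable def gaussianKernel (l : ℝ) (s : ℝ × ℝ) : ℝ :=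
  (∫ s, planeGaussian s)⁻¹ * l ^ 2 * planeGaussian (l • s)

lemma continuous_gaussianKernel (l : ℝ) : Continuous (gaussianKernel l) := by
  have := continuous_planeGaussian
  unfold gaussianKernel
  fun_prop

lemma gaussianKernel_nonneg (l : ℝ) (s : ℝ × ℝ) : 0 ≤ gaussianKernel l s := by
  have := integral_planeGaussian_pos
  have : 0 ≤ planeGaussian (l • s) := (Real.exp_pos _).le
  unfold gaussianKernel
  positivity

lemma integrable_gaussianKernel {l : ℝ} (hl : 0 < l) : Integrable (gaussianKernel l) :=
  (integrable_planeGaussian.comp_smul hl.ne').const_mul _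

lemma integral_gaussianKernel {l : ℝ} (hl : 0 < l) : ∫ s, gaussianKernel l s = 1 := by
  have hA := integral_planeGaussian_pos
  unfold gaussianKernel
  rw [integral_const_mul, Measure.integral_comp_smul, abs_of_pos (by positivity)]
  simp only [Module.finrank_prod, Module.finrank_self, smul_eq_mul]
  field_simp

lemma integrable_gaussianKernel_mul_norm {l : ℝ} (hl : 0 < l) :
    Integrable fun s => gaussianKernel l s * ‖s‖ := by
  refine ((integrable_planeGaussian_mul_norm.comp_smul hl.ne').const_mul
    ((∫ s, planeGaussian s)⁻¹ * l ^ 2 * l⁻¹)).congr (Eventually.of_forall fun s => ?_)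
  simp only [gaussianKernel, norm_smul, Real.norm_of_nonneg hl.le]
  field_simp

lemma exists_gaussianKernel_first_moment :
    ∃ M : ℝ, 0 ≤ M ∧ ∀ l : ℝ, 0 < l → ∫ s, gaussianKernel l s * ‖s‖ = M / l := by
  have hA := integral_planeGaussian_pos
  refine ⟨(∫ s, planeGaussian s)⁻¹ * ∫ s, planeGaussian s * ‖s‖, ?_, fun l hl => ?_⟩
  · have : 0 ≤ ∫ s, planeGaussian s * ‖s‖ :=
      integral_nonneg fun s => mul_nonneg (Real.exp_pos _).le (norm_nonneg _)
    positivity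
  · have h : ∀ s, gaussianKernel l s * ‖s‖ = (∫ s, planeGaussian s)⁻¹ * l ^ 2 * l⁻¹ *
        (fun s => planeGaussian s * ‖s‖) (l • s) := fun s => by
      simp only [gaussianKernel, norm_smul, Real.norm_of_nonneg hl.le]
      field_simp
    rw [integral_congr_ae (Eventually.of_forall h), integral_const_mul,
      Measure.integral_comp_smul volume (fun s : ℝ × ℝ => planeGaussian s * ‖s‖),
      abs_of_pos (by positivity)]
    simp only [Module.finrank_prod, Module.finrank_self, smul_eq_mul]
    field_simp

lemma norm_integral_gaussianKernel_smul_sub_le {W : Type*} [NormedAddCommGroup W]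
    [NormedSpace ℝ W] [CompleteSpace W] {l K : ℝ} (hl : 0 < l) {v : ℝ × ℝ → W}
    (hv : Continuous v) (hc : HasCompactSupport v) (hK : ∀ x y, ‖v x - v y‖ ≤ K * ‖x - y‖)
    (x : ℝ × ℝ) :
    ‖(∫ t, gaussianKernel l (x - t) • v t) - v x‖ ≤ K * ∫ s, gaussianKernel l s * ‖s‖ := by
  have hk := continuous_gaussianKernel l
  have i1 : Integrable fun t => gaussianKernel l (x - t) • v t :=
    Continuous.integrable_of_hasCompactSupport (by fun_prop) hc.smul_left
  have i2 : Integrable fun t => gaussianKernel l (x - t) • v x :=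
    ((integrable_gaussianKernel hl).comp_sub_left x).smul_const _
  have e : v x = ∫ t, gaussianKernel l (x - t) • v x := by
    rw [integral_smul_const, integral_sub_left_eq_self (gaussianKernel l) volume x,
      integral_gaussianKernel hl, one_smul]
  conv_lhs => rw [e]
  rw [← integral_sub i1 i2, ← integral_const_mul,
    ← integral_sub_left_eq_self (fun s => K * (gaussianKernel l s * ‖s‖)) volume x]
  refine norm_integral_le_of_norm_le
    (((integrable_gaussianKernel_mul_norm hl).const_mul K).comp_sub_left x)
    (Eventually.of_forall fun t => ?_)
  rw [← smul_sub, norm_smul, Real.norm_of_nonneg (gaussianKernel_nonneg _ _), norm_sub_rev]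
  calc _ ≤ gaussianKernel l (x - t) * (K * ‖x - t‖) :=
        mul_le_mul_of_nonneg_left (hK x t) (gaussianKernel_nonneg _ _)
    _ = _ := by ring

/-- The Gaussian regularisation of `u` at scale `1 / l`. -/
noncomputable def gaussianSmooth (u : ℝ × ℝ → ℝ) (l : ℝ) : ℝ × ℝ → ℝ :=
  u ⋆[ContinuousLinearMap.mul ℝ ℝ, volume] gaussianKernel l

lemma gaussianSmooth_apply (u : ℝ × ℝ → ℝ) (l : ℝ) (x : ℝ × ℝ) :
    gaussianSmooth u l x = ∫ t, gaussianKernel l (x - t) • u t := by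
  simp [gaussianSmooth, convolution_def, mul_comm]

lemma contDiff_gaussianSmooth {u : ℝ × ℝ → ℝ} {n : ℕ∞} (hu : ContDiff ℝ n u)
    (hc : HasCompactSupport u) (l : ℝ) : ContDiff ℝ n (gaussianSmooth u l) :=
  hc.contDiff_convolution_left _ hu (continuous_gaussianKernel l).locallyIntegrable

lemma fderiv_gaussianSmooth {u : ℝ × ℝ → ℝ} (hu : ContDiff ℝ 1 u)
    (hc : HasCompactSupport u) (l : ℝ) (x : ℝ × ℝ) :
    fderiv ℝ (gaussianSmooth u l) x = ∫ t, gaussianKernel l (x - t) • fderiv ℝ u t := by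
  have h := hc.hasFDerivAt_convolution_left (ContinuousLinearMap.mul ℝ ℝ) hu
    (continuous_gaussianKernel l).locallyIntegrable (μ := volume) x
  refine h.fderiv.trans ?_
  rw [convolution_def]
  refine integral_congr_ae (Eventually.of_forall fun t => ?_)
  ext <;> simp [mul_comm]

lemma exists_gaussianSmooth_approx {u : ℝ × ℝ → ℝ} (hu : ContDiff ℝ (⊤ : ℕ∞) u)
    (hc : HasCompactSupport u) {δ : ℝ} (hδ : 0 < δ) :
    ∀ᶠ l : ℝ in atTop, ∀ x, |gaussianSmooth u l x - u x| ≤ δ ∧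
      ‖fderiv ℝ (gaussianSmooth u l) x - fderiv ℝ u x‖ ≤ δ := by
  obtain ⟨M, hM0, hM⟩ := exists_gaussianKernel_first_moment
  have hu' : ContDiff ℝ (⊤ : ℕ∞) (fderiv ℝ u) := hu.fderiv_right (by simp)
  obtain ⟨K, hK⟩ := hu.lipschitzWith_of_hasCompactSupport hc (by simp)
  obtain ⟨K', hK'⟩ := hu'.lipschitzWith_of_hasCompactSupport (hc.fderiv ℝ) (by simp)
  have ht : ∀ C : ℝ, ∀ᶠ l : ℝ in atTop, C * (M / l) ≤ δ := fun C => by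
    have h : Tendsto (fun l : ℝ => C * (M / l)) atTop (𝓝 (C * 0)) :=
      (tendsto_const_nhds.div_atTop tendsto_id).const_mul C
    rw [mul_zero] at h
    exact (h.eventually_lt_const hδ).mono fun _ => le_of_lt
  filter_upwards [ht K, ht K', eventually_gt_atTop 0] with l h1 h2 hl x
  rw [← hM l hl] at h1 h2
  constructor
  · rw [gaussianSmooth_apply]
    exact (norm_integral_gaussianKernel_smul_sub_le hl hu.continuous hc
      (fun x y => hK.norm_sub_le x y) x).trans h1
  · rw [fderiv_gaussianSmooth (hu.of_le (by simp)) hc]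
    exact (norm_integral_gaussianKernel_smul_sub_le hl hu'.continuous (hc.fderiv ℝ)
      (fun x y => hK'.norm_sub_le x y) x).trans h2

/-- The holomorphic extension of `gaussianSmooth u l`. -/
noncomputable def gaussianExtension (u : ℝ × ℝ → ℝ) (l : ℝ) (z : ℂ × ℂ) : ℂ :=
  ∫ t : ℝ × ℝ, (((∫ s, planeGaussian s)⁻¹ * l ^ 2 * u t : ℝ) : ℂ) *
    Complex.exp (-(l ^ 2 * ((z.1 - t.1) ^ 2 + (z.2 - t.2) ^ 2)))

lemma gaussianExtension_ofReal (u : ℝ × ℝ → ℝ) (l x y : ℝ) :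
    gaussianExtension u l (x, y) = gaussianSmooth u l (x, y) := by
  rw [gaussianSmooth_apply, gaussianExtension, ← integral_complex_ofReal]
  refine integral_congr_ae (Eventually.of_forall fun t => ?_)
  simp only [gaussianKernel, planeGaussian, Prod.fst_sub, Prod.snd_sub, Prod.smul_fst,
    Prod.smul_snd, smul_eq_mul]
  push_cast
  ring_nf

lemma differentiable_gaussianExtension {u : ℝ × ℝ → ℝ} (hu : Continuous u)
    (hc : HasCompactSupport u) (l : ℝ) : Differentiable ℂ (gaussianExtension u l) := by
  intro z₀
  set c : ℝ := (∫ s, planeGaussian s)⁻¹ * l ^ 2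
  let Φ : ℂ × ℂ → ℝ × ℝ → ℂ := fun z t => ((c * u t : ℝ) : ℂ) *
    Complex.exp (-(l ^ 2 * ((z.1 - t.1) ^ 2 + (z.2 - t.2) ^ 2)))
  let Φ' : ℂ × ℂ → ℝ × ℝ → (ℂ × ℂ →L[ℂ] ℂ) := fun z t =>
    (Φ z t * (-l ^ 2 * 2)) • ((z.1 - t.1) • ContinuousLinearMap.fst ℂ ℂ ℂ +
      (z.2 - t.2) • ContinuousLinearMap.snd ℂ ℂ ℂ)
  have hΦc : Continuous fun p : (ℂ × ℂ) × (ℝ × ℝ) => Φ p.1 p.2 := by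
    simp only [Φ]; fun_prop
  have hΦ'c : Continuous fun p : (ℂ × ℂ) × (ℝ × ℝ) => Φ' p.1 p.2 := by
    simp only [Φ']; fun_prop
  have hd : ∀ z t, HasFDerivAt (Φ · t) (Φ' z t) z := fun z t => by
    have h1 : HasFDerivAt (fun z : ℂ × ℂ => z.1 - (t.1 : ℂ)) (ContinuousLinearMap.fst ℂ ℂ ℂ) z :=
      hasFDerivAt_fst.sub_const _
    have h2 : HasFDerivAt (fun z : ℂ × ℂ => z.2 - (t.2 : ℂ)) (ContinuousLinearMap.snd ℂ ℂ ℂ) z :=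
      hasFDerivAt_snd.sub_const _
    have h := ((((h1.pow 2).add (h2.pow 2)).const_mul ((l : ℂ) ^ 2)).neg.cexp).const_mul
      (((c * u t : ℝ) : ℂ))
    refine h.congr_fderiv ?_
    ext <;> simp [Φ', Φ] <;> ring
  obtain ⟨C, hC⟩ := ((isCompact_closedBall z₀ 1).prod hc).exists_bound_of_continuousOn
    hΦ'c.continuousOn
  have hz : ∀ z, ∀ t ∉ tsupport u, Φ z t = 0 := fun z t ht => by
    simp [Φ, image_eq_zero_of_notMem_tsupport ht]
  have hcs : ∀ z, HasCompactSupport (Φ z) := fun z => HasCompactSupport.intro hc (hz z)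
  refine HasFDerivAt.differentiableAt (f' := ∫ t, Φ' z₀ t) ?_
  refine hasFDerivAt_integral_of_dominated_of_fderiv_le (F := Φ) (F' := Φ')
    (bound := (tsupport u).indicator fun _ => C)
    (Metric.closedBall_mem_nhds z₀ one_pos)
    (Eventually.of_forall fun z => (hΦc.comp (by fun_prop :
      Continuous fun t : ℝ × ℝ => (z, t))).aestronglyMeasurable)
    (Continuous.integrable_of_hasCompactSupport (hΦc.comp (by fun_prop :
      Continuous fun t : ℝ × ℝ => (z₀, t))) (hcs z₀))
    (hΦ'c.comp (by fun_prop : Continuous fun t : ℝ × ℝ => (z₀, t))).aestronglyMeasurable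
    (Eventually.of_forall fun t z hzz => ?_) ?_
    (Eventually.of_forall fun t z _ => hd z t)
  · by_cases ht : t ∈ tsupport u
    · simpa [ht] using hC (z, t) ⟨hzz, ht⟩
    · have h0 : Φ' z t = 0 := by ext <;> simp [Φ', hz z t ht]
      simp [ht, h0]
  · rw [integrable_indicator_iff (isClosed_tsupport u).measurableSet]
    exact integrableOn_const hc.measure_lt_top.ne

lemma eventually_gaussianExtension_small {u : ℝ × ℝ → ℝ} (hu : Continuous u)
    (hc : HasCompactSupport u) {R δ : ℝ} (h0 : ∀ t, ‖t‖ < R → u t = 0) (hδ : 0 < δ) :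
    ∀ᶠ l : ℝ in atTop, ∀ z : ℂ × ℂ, ‖z‖ < R / 4 → ‖gaussianExtension u l z‖ ≤ δ := by
  rcases le_or_gt R 0 with hR | hR
  · exact Eventually.of_forall fun l z hz => absurd (norm_nonneg z) (by linarith)
  set A := (∫ s, planeGaussian s)⁻¹
  have hA0 : 0 < A := inv_pos.2 integral_planeGaussian_pos
  have hint : Integrable fun t => |u t| :=
    (hu.integrable_of_hasCompactSupport hc).abs
  have hlim : Tendsto (fun l : ℝ => (A * ∫ t, |u t|) * (l ^ 2 * Real.exp (-(R ^ 2 / 4) * l ^ 2)))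
      atTop (𝓝 ((A * ∫ t, |u t|) * 0)) := by
    refine Tendsto.const_mul _ ?_
    have h := (Real.tendsto_pow_mul_exp_neg_atTop_nhds_zero 1).comp
      ((tendsto_pow_atTop (α := ℝ) two_ne_zero).const_mul_atTop (show 0 < R ^ 2 / 4 by positivity))
    have h' := h.const_mul (R ^ 2 / 4)⁻¹
    rw [mul_zero] at h'
    refine h'.congr fun l => ?_
    simp only [Function.comp, pow_one]
    rw [neg_mul]
    field_simp
  rw [mul_zero] at hlim
  filter_upwards [hlim.eventually_lt_const hδ] with l hl z hz
  refine le_trans ?_ hl.le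
  have : (A * ∫ t, |u t|) * (l ^ 2 * Real.exp (-(R ^ 2 / 4) * l ^ 2)) =
      ∫ t, (A * (l ^ 2 * Real.exp (-(R ^ 2 / 4) * l ^ 2))) * |u t| := by
    rw [integral_const_mul]; ring
  rw [this]
  refine norm_integral_le_of_norm_le (hint.const_mul _) (Eventually.of_forall fun t => ?_)
  by_cases ht : ‖t‖ < R
  · simp [h0 t ht]
  have hre : ((-(l ^ 2 * ((z.1 - t.1) ^ 2 + (z.2 - t.2) ^ 2)) : ℂ)).re ≤ -(R ^ 2 / 4) * l ^ 2 := by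
    have e : ((-(l ^ 2 * ((z.1 - t.1) ^ 2 + (z.2 - t.2) ^ 2)) : ℂ)).re =
        -(l ^ 2 * ((z.1.re - t.1) ^ 2 - z.1.im ^ 2 + ((z.2.re - t.2) ^ 2 - z.2.im ^ 2))) := by
      simp [pow_two]
    have hz1 : z.1.re ^ 2 + z.1.im ^ 2 ≤ R ^ 2 / 16 := by
      have h := (norm_fst_le z).trans hz.le
      have := pow_le_pow_left₀ (norm_nonneg _) h 2
      rw [Complex.sq_norm, Complex.normSq_apply] at this
      nlinarith
    have hz2 : z.2.re ^ 2 + z.2.im ^ 2 ≤ R ^ 2 / 16 := by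
      have h := (norm_snd_le z).trans hz.le
      have := pow_le_pow_left₀ (norm_nonneg _) h 2
      rw [Complex.sq_norm, Complex.normSq_apply] at this
      nlinarith
    have ht2 : R ^ 2 ≤ t.1 ^ 2 + t.2 ^ 2 := by
      rw [not_lt, Prod.norm_def, le_max_iff] at ht
      rcases ht with h | h <;>
      · have := pow_le_pow_left₀ hR.le h 2
        rw [Real.norm_eq_abs, sq_abs] at this
        nlinarith [sq_nonneg t.1, sq_nonneg t.2]
    have key : R ^ 2 / 4 ≤
        (z.1.re - t.1) ^ 2 - z.1.im ^ 2 + ((z.2.re - t.2) ^ 2 - z.2.im ^ 2) := by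
      nlinarith [sq_nonneg (2 * z.1.re - t.1), sq_nonneg (2 * z.2.re - t.2)]
    rw [e]
    nlinarith [mul_le_mul_of_nonneg_left key (sq_nonneg l)]
  rw [norm_mul, Complex.norm_exp, Complex.norm_real, Real.norm_eq_abs, abs_mul,
    abs_of_nonneg (by positivity : 0 ≤ A * l ^ 2)]
  calc _ ≤ A * l ^ 2 * |u t| * Real.exp (-(R ^ 2 / 4) * l ^ 2) := by gcongr
    _ = _ := by ring

/-- The function `g` is differentiable at `x`, where `g` and its derivative are bounded by `c`. -/
def HasC1Bound (g : ℝ × ℝ → ℝ) (x : ℝ × ℝ) (c : ℝ) : Prop :=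
  ∃ g' : ℝ × ℝ →L[ℝ] ℝ, HasFDerivAt g g' x ∧ |g x| ≤ c ∧ ‖g'‖ ≤ c

namespace HasC1Bound

variable {g k : ℝ × ℝ → ℝ} {x : ℝ × ℝ} {c d : ℝ}

lemma add (hg : HasC1Bound g x c) (hk : HasC1Bound k x d) :
    HasC1Bound (fun y => g y + k y) x (c + d) := by
  obtain ⟨g', h1, h2, h3⟩ := hg
  obtain ⟨k', h4, h5, h6⟩ := hk
  exact ⟨g' + k', h1.add h4, (abs_add_le _ _).trans (add_le_add h2 h5),
    (norm_add_le _ _).trans (add_le_add h3 h6)⟩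

lemma neg (hg : HasC1Bound g x c) : HasC1Bound (fun y => -g y) x c := by
  obtain ⟨g', h1, h2, h3⟩ := hg
  exact ⟨-g', h1.neg, by rwa [abs_neg], by rwa [norm_neg]⟩

lemma congr (hg : HasC1Bound g x c) (h : k =ᶠ[𝓝 x] g) : HasC1Bound k x c := by
  obtain ⟨g', h1, h2, h3⟩ := hg
  exact ⟨g', h1.congr_of_eventuallyEq h, by rwa [h.eq_of_nhds], h3⟩

lemma mono (hg : HasC1Bound g x c) (h : c ≤ d) : HasC1Bound g x d := by
  obtain ⟨g', h1, h2, h3⟩ := hg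
  exact ⟨g', h1, h2.trans h, h3.trans h⟩

lemma mul (hg : HasC1Bound g x c) (hk : HasC1Bound k x d) :
    HasC1Bound (fun y => g y * k y) x (2 * c * d) := by
  obtain ⟨g', h1, h2, h3⟩ := hg
  obtain ⟨k', h4, h5, h6⟩ := hk
  have hc : 0 ≤ c := (abs_nonneg _).trans h2
  have hd : 0 ≤ d := (abs_nonneg _).trans h5
  refine ⟨_, h1.mul h4, ?_, ?_⟩
  · rw [abs_mul]
    have := mul_le_mul h2 h5 (abs_nonneg _) hc
    nlinarith [mul_nonneg hc hd]
  · refine (norm_add_le _ _).trans ?_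
    rw [norm_smul, norm_smul, Real.norm_eq_abs, Real.norm_eq_abs]
    have e1 := mul_le_mul h2 h6 (norm_nonneg _) hc
    have e2 := mul_le_mul h5 h3 (norm_nonneg _) hd
    linarith

lemma tsum {h : ℕ → ℝ × ℝ → ℝ} {u : ℕ → ℝ} (hu : Summable u) {r : ℝ}
    (hb : ∀ i, ∀ y, ‖y‖ < r → HasC1Bound (h i) y (u i)) (hx : ‖x‖ < r) :
    HasC1Bound (fun y => ∑' i, h i y) x (∑' i, u i) := by
  choose! h' h1 h2 h3 using hb
  have hx' : x ∈ Metric.ball (0 : ℝ × ℝ) r := by simpa using hx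
  refine ⟨_, hasFDerivAt_tsum_of_isPreconnected hu Metric.isOpen_ball
    (convex_ball _ _).isPreconnected (fun n y hy => h1 n y (by simpa using hy))
    (fun n y hy => h3 n y (by simpa using hy)) hx'
    (Summable.of_norm_bounded hu fun i => (h2 i x hx : ‖h i x‖ ≤ u i)) hx', ?_, ?_⟩
  · exact tsum_of_norm_bounded (f := fun i => h i x) hu.hasSum fun i => h2 i x hx
  · exact tsum_of_norm_bounded hu.hasSum fun i => h3 i x hx

end HasC1Bound

lemma exists_entire_approx {u : ℝ × ℝ → ℝ} (hu : ContDiff ℝ (⊤ : ℕ∞) u)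
    (hc : HasCompactSupport u) {R δ : ℝ} (h0 : ∀ t, ‖t‖ < R → u t = 0) (hδ : 0 < δ) :
    ∃ (h : ℝ × ℝ → ℝ) (H : ℂ × ℂ → ℂ), ContDiff ℝ (⊤ : ℕ∞) h ∧ Differentiable ℂ H ∧
      (∀ x y : ℝ, H (x, y) = h (x, y)) ∧ (∀ x, HasC1Bound (fun y => h y - u y) x δ) ∧
      ∀ z, ‖z‖ < R / 4 → ‖H z‖ ≤ δ := by
  obtain ⟨l, h1, h2⟩ := ((exists_gaussianSmooth_approx hu hc hδ).and
    (eventually_gaussianExtension_small hu.continuous hc h0 hδ)).exists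
  have hs := contDiff_gaussianSmooth hu hc l
  refine ⟨gaussianSmooth u l, gaussianExtension u l, hs,
    differentiable_gaussianExtension hu.continuous hc l, gaussianExtension_ofReal u l,
    fun x => ⟨_, ?_, (h1 x).1, (h1 x).2⟩, h2⟩
  exact (hs.differentiable (by simp) x).hasFDerivAt.sub (hu.differentiable (by simp) x).hasFDerivAt

lemma exists_annular_cutoff (n : ℕ) :
    ∃ ρ : ℝ × ℝ → ℝ, ContDiff ℝ (⊤ : ℕ∞) ρ ∧ HasCompactSupport ρ ∧
      (∀ x, n ≤ ‖x‖ → ‖x‖ < n + 1 → ρ =ᶠ[𝓝 x] 1) ∧ (∀ x, ‖x‖ < (n : ℝ) - 1 → ρ x = 0) := by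
  let b : ContDiffBump (0 : ℝ × ℝ) := ⟨n + 1, n + 2, by positivity, by linarith⟩
  have hb1 : ∀ x : ℝ × ℝ, ‖x‖ < n + 1 → b =ᶠ[𝓝 x] 1 := fun x hx =>
    b.eventuallyEq_one_of_mem_ball (by simpa using hx)
  rcases le_or_gt n 1 with hn | hn
  · refine ⟨b, b.contDiff, b.hasCompactSupport, fun x _ hx => hb1 x hx, fun x hx => ?_⟩
    have : (n : ℝ) ≤ 1 := by exact_mod_cast hn
    exact absurd (norm_nonneg x) (by linarith)
  · have hn' : (1 : ℝ) < n := by exact_mod_cast hn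
    let a : ContDiffBump (0 : ℝ × ℝ) := ⟨n - 1, n - 1 / 2, by linarith, by linarith⟩
    refine ⟨fun x => b x * (1 - a x), b.contDiff.mul (contDiff_const.sub a.contDiff),
      b.hasCompactSupport.mul_right, fun x h1 h2 => ?_, fun x hx => ?_⟩
    · have hx : x ∈ (Metric.closedBall (0 : ℝ × ℝ) (n - 1 / 2))ᶜ := by
        simp only [Set.mem_compl_iff, mem_closedBall_zero_iff]
        linarith
      filter_upwards [hb1 x h2, Metric.isClosed_closedBall.isOpen_compl.mem_nhds hx] with y hy hy'
      have : a y = 0 := a.zero_of_le_dist (by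
        simp only [Set.mem_compl_iff, mem_closedBall_zero_iff] at hy'
        simpa [a] using (not_le.1 hy').le)
      simp [hy, this]
    · have : a x = 1 := a.one_of_mem_closedBall (by simpa [a] using hx.le)
      simp [this]

lemma exists_hasC1Bound_of_hasCompactSupport {ρ : ℝ × ℝ → ℝ} (hρ : ContDiff ℝ (⊤ : ℕ∞) ρ)
    (hc : HasCompactSupport ρ) : ∃ C, ∀ x, HasC1Bound ρ x C := by
  obtain ⟨C₁, h1⟩ := hc.exists_bound_of_continuous hρ.continuous
  obtain ⟨C₂, h2⟩ := (hc.fderiv ℝ).exists_bound_of_continuous (hρ.continuous_fderiv (by simp))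
  exact ⟨max C₁ C₂, fun x => ⟨_, (hρ.differentiable (by simp) x).hasFDerivAt,
    (h1 x).trans (le_max_left _ _), (h2 x).trans (le_max_right _ _)⟩⟩

lemma exists_entire_correction {f : ℝ × ℝ → ℝ} (hf : ContDiff ℝ (⊤ : ℕ∞) f) (n : ℕ) :
    ∃ C : ℝ, 0 ≤ C ∧ ∀ δ : ℝ, 0 < δ → ∀ S : ℝ × ℝ → ℝ, ContDiff ℝ (⊤ : ℕ∞) S →
      ∃ (h : ℝ × ℝ → ℝ) (H : ℂ × ℂ → ℂ), ContDiff ℝ (⊤ : ℕ∞) h ∧ Differentiable ℂ H ∧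
        (∀ x y : ℝ, H (x, y) = h (x, y)) ∧
        (∀ x, n ≤ ‖x‖ → ‖x‖ < n + 1 → HasC1Bound (fun y => (S y + h y) - f y) x δ) ∧
        (∀ x, ‖x‖ < (n : ℝ) - 1 → HasC1Bound h x δ) ∧
        (∀ x c, HasC1Bound (fun y => S y - f y) x c → HasC1Bound h x (C * c + δ)) ∧
        ∀ z, ‖z‖ < ((n : ℝ) - 1) / 4 → ‖H z‖ ≤ δ := by
  obtain ⟨ρ, hρ, hρc, hρ1, hρ0⟩ := exists_annular_cutoff n
  obtain ⟨C, hC⟩ := exists_hasC1Bound_of_hasCompactSupport hρ hρc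
  have hC0 : 0 ≤ C := by
    obtain ⟨_, _, h, _⟩ := hC 0
    exact (abs_nonneg _).trans h
  refine ⟨2 * C, by positivity, fun δ hδ S hS => ?_⟩
  obtain ⟨h, H, h1, h2, h3, h4, h5⟩ := exists_entire_approx (u := fun x => ρ x * (f x - S x))
    (hρ.mul (hf.sub hS)) hρc.mul_right (R := (n : ℝ) - 1) (fun t ht => by simp [hρ0 t ht]) hδ
  refine ⟨h, H, h1, h2, h3, fun x hx hx' => ?_, fun x hx => ?_, fun x c hx => ?_, h5⟩
  · refine (h4 x).congr ?_
    filter_upwards [hρ1 x hx hx'] with y hy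
    simp only [hy, Pi.one_apply]
    ring
  · refine (h4 x).congr ?_
    have hx' : x ∈ Metric.ball (0 : ℝ × ℝ) (n - 1) := by simpa using hx
    filter_upwards [Metric.isOpen_ball.mem_nhds hx'] with y hy
    simp [hρ0 y (by simpa using hy)]
  · refine (((hC x).mul hx.neg).add (h4 x)).congr (Eventually.of_forall fun y => ?_)
    ring

lemma norm_fderiv_le_of_norm_le {H : ℂ × ℂ → ℂ} (hH : Differentiable ℂ H) {z : ℂ × ℂ} {c : ℝ}
    (hc : 0 ≤ c) (hb : ∀ w, ‖w - z‖ ≤ 1 → ‖H w‖ ≤ c) : ‖fderiv ℂ H z‖ ≤ c := by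
  have unit : ∀ v : ℂ × ℂ, ‖v‖ = 1 → ‖fderiv ℂ H z v‖ ≤ c := fun v hv => by
    have hl : ∀ t : ℂ, HasDerivAt (fun t : ℂ => z + t • v) v t := fun t => by
      simpa using ((hasDerivAt_id t).smul_const v).const_add z
    have hd : HasDerivAt (fun t : ℂ => H (z + t • v)) (fderiv ℂ H z v) 0 := by
      have h := (hH (z + (0 : ℂ) • v)).hasFDerivAt.comp_hasDerivAt (0 : ℂ) (hl 0)
      simpa [Function.comp_def] using h
    have hD : Differentiable ℂ fun t : ℂ => H (z + t • v) := fun t =>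
      ((hH _).hasFDerivAt.comp_hasDerivAt t (hl t)).differentiableAt
    have h := Complex.norm_deriv_le_of_forall_mem_sphere_norm_le (c := 0) (C := c) one_pos
      hD.diffContOnCl (fun t ht => hb _ (by
        have : ‖t‖ = 1 := by simpa using ht
        simp [norm_smul, hv, this]))
    rwa [hd.deriv, div_one] at h
  refine ContinuousLinearMap.opNorm_le_bound _ hc fun v => ?_
  rcases eq_or_ne v 0 with rfl | hv
  · simp
  · have hn : (‖v‖ : ℂ) ≠ 0 := by simpa using hv
    have h := unit ((‖v‖ : ℂ)⁻¹ • v) (by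
      rw [norm_smul, norm_inv, Complex.norm_real, norm_norm,
        inv_mul_cancel₀ (norm_ne_zero_iff.2 hv)])
    rw [map_smul, norm_smul, norm_inv, Complex.norm_real, norm_norm,
      inv_mul_le_iff₀ (norm_pos_iff.2 hv)] at h
    linarith

lemma differentiable_tsum_of_norm_le {H : ℕ → ℂ × ℂ → ℂ} (hH : ∀ n, Differentiable ℂ (H n))
    {u : ℕ → ℝ} (hu : Summable u) (hu0 : ∀ n, 0 ≤ u n)
    (hb : ∀ (n : ℕ) (z : ℂ × ℂ), ‖z‖ < ((n : ℝ) - 1) / 4 → ‖H n z‖ ≤ u n) :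
    (∀ z, Summable fun n => H n z) ∧ Differentiable ℂ fun z => ∑' n, H n z := by
  have hs : ∀ z, Summable fun n => H n z := fun z => by
    obtain ⟨N, hN⟩ := exists_nat_gt (4 * ‖z‖ + 1)
    rw [← summable_nat_add_iff N]
    refine Summable.of_norm_bounded ((summable_nat_add_iff N).2 hu) fun i => hb _ _ ?_
    push_cast
    have : (0 : ℝ) ≤ i := i.cast_nonneg
    linarith
  refine ⟨hs, fun z => ?_⟩
  obtain ⟨N, hN⟩ := exists_nat_gt (4 * (‖z‖ + 2) + 1)
  have hz : z ∈ Metric.ball (0 : ℂ × ℂ) (‖z‖ + 1) := by simp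
  have e : (fun z => ∑' n, H n z) =
      fun z => (∑ i ∈ Finset.range N, H i z) + ∑' i, H (i + N) z :=
    funext fun z => ((hs z).sum_add_tsum_nat_add N).symm
  rw [e]
  refine DifferentiableAt.add (DifferentiableAt.fun_sum fun i _ => hH i z) ?_
  refine (hasFDerivAt_tsum_of_isPreconnected ((summable_nat_add_iff N).2 hu) Metric.isOpen_ball
    (convex_ball (0 : ℂ × ℂ) (‖z‖ + 1)).isPreconnected
    (fun n y _ => (hH (n + N) y).hasFDerivAt) (fun n y hy => ?_) hz
    ((summable_nat_add_iff N).2 (hs z)) hz).differentiableAt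
  refine norm_fderiv_le_of_norm_le (hH _) (hu0 _) fun w hw => hb _ _ ?_
  have h1 : ‖y‖ < ‖z‖ + 1 := by simpa using hy
  have h2 : ‖w‖ ≤ ‖w - y‖ + ‖y‖ := norm_le_norm_sub_add w y
  push_cast
  have : (0 : ℝ) ≤ n := n.cast_nonneg
  linarith

lemma exists_antitone_lower_bound {ε : ℝ × ℝ → ℝ} (hε : Continuous ε) (hpos : ∀ x, 0 < ε x) :
    ∃ η : ℕ → ℝ, Antitone η ∧ (∀ n, 0 < η n) ∧ ∀ n : ℕ, ∀ x, ‖x‖ ≤ n + 1 → η n ≤ ε x := by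
  have h : ∀ n : ℕ, ∃ m ∈ Metric.closedBall (0 : ℝ × ℝ) (n + 1),
      IsMinOn ε (Metric.closedBall 0 (n + 1)) m := fun n =>
    (isCompact_closedBall _ _).exists_isMinOn ⟨0, by simp; positivity⟩ hε.continuousOn
  choose m hm hmin using h
  refine ⟨fun n => ε (m n), fun a b hab => hmin b (Metric.closedBall_subset_closedBall ?_ (hm a)),
    fun n => hpos _, fun n x hx => hmin n (by simpa using hx)⟩
  have : (a : ℝ) ≤ b := by exact_mod_cast hab
  linarith

lemma exists_entire_c1_approx {f : ℝ × ℝ → ℝ} (hf : ContDiff ℝ (⊤ : ℕ∞) f) {η : ℕ → ℝ}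
    (hanti : Antitone η) (hη : ∀ n, 0 < η n) :
    ∃ F : ℝ × ℝ → ℝ, IsEntire F ∧
      ∀ n : ℕ, ∀ x, n ≤ ‖x‖ → ‖x‖ < n + 1 → HasC1Bound (fun y => F y - f y) x (η n / 4) := by
  choose C hC0 hstep using exists_entire_correction hf
  set d : ℕ → ℝ := fun n => η n / 8 * (1 / 2) ^ n with hd
  have hd0 : ∀ n, 0 < d n := fun n => by have := hη n; positivity
  have hdle : ∀ n i, d (i + n) ≤ η n / 8 * (1 / 2) ^ i := fun n i => by
    have h1 : η (i + n) ≤ η n := hanti (by lia)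
    have h2 : ((1 : ℝ) / 2) ^ (i + n) ≤ (1 / 2) ^ i :=
      pow_le_pow_of_le_one (by norm_num) (by norm_num) (by lia)
    have := hη n
    simp only [hd]
    gcongr
  have hgeo : ∀ n, HasSum (fun i : ℕ => η n / 8 * (1 / 2) ^ i) (η n / 4) := fun n => by
    have h := hasSum_geometric_two.mul_left (η n / 8)
    rwa [show η n / 8 * 2 = η n / 4 by ring] at h
  have hdsum : Summable d := by
    refine Summable.of_nonneg_of_le (fun n => (hd0 n).le) (fun i => ?_) (hgeo 0).summable
    simpa using hdle 0 i
  have hdtail : ∀ n, ∑' i, d (i + n) ≤ η n / 4 := fun n =>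
    (((summable_nat_add_iff n).2 hdsum).tsum_le_tsum (hdle n) (hgeo n).summable).trans_eq
      (hgeo n).tsum_eq
  set δ : ℕ → ℝ := fun n => d n / (1 + C (n + 1)) with hδ
  have hC1 : ∀ n, 0 < 1 + C n := fun n => by have := hC0 n; linarith
  have hδ0 : ∀ n, 0 < δ n := fun n => div_pos (hd0 n) (hC1 _)
  have hδd : ∀ n, δ n ≤ d n := fun n =>
    div_le_self (hd0 n).le (by have := hC0 (n + 1); linarith)
  have hδC : ∀ n, δ n + C (n + 1) * δ n = d n := fun n => by
    have := (hC1 (n + 1)).ne'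
    simp only [hδ]
    field_simp
  have hδsum : Summable δ := Summable.of_nonneg_of_le (fun n => (hδ0 n).le) hδd hdsum
  choose k K hk hK hkK hshell hball hstable hcone using fun n => hstep n (δ n) (hδ0 n)
  let T : ℕ → {S : ℝ × ℝ → ℝ // ContDiff ℝ (⊤ : ℕ∞) S} := fun n =>
    Nat.rec ⟨fun _ => 0, contDiff_const⟩
      (fun n S => ⟨fun x => S.1 x + k n S.1 S.2 x, S.2.add (hk n S.1 S.2)⟩) n
  let S : ℕ → ℝ × ℝ → ℝ := fun n => (T n).1
  let h : ℕ → ℝ × ℝ → ℝ := fun n => k n (S n) (T n).2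
  let H : ℕ → ℂ × ℂ → ℂ := fun n => K n (S n) (T n).2
  have hS : ∀ n x, S n x = ∑ i ∈ Finset.range n, h i x := fun n x => by
    induction n with
    | zero => rfl
    | succ n ih => rw [Finset.sum_range_succ, ← ih]
  obtain ⟨hHs, hHd⟩ := differentiable_tsum_of_norm_le (H := H) (fun n => hK n _ _) hδsum
    (fun n => (hδ0 n).le) (fun n => hcone n _ _)
  have hHh : ∀ (n : ℕ) (x y : ℝ), H n (x, y) = h n (x, y) := fun n => hkK n _ _
  have hhs : ∀ x, Summable fun n => h n x := fun x => by
    have := hHs (x.1, x.2)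
    simp only [hHh] at this
    exact_mod_cast this
  refine ⟨fun x => ∑' n, h n x, ⟨_, hHd, fun x y => ?_⟩, fun n x hx hx' => ?_⟩
  · simp only [hHh]
    exact (Complex.ofReal_tsum _).symm
  have h1 : HasC1Bound (fun y => S (n + 1) y - f y) x (δ n) := hshell n _ _ x hx hx'
  have h2 : HasC1Bound (h (n + 1)) x (C (n + 1) * δ n + δ (n + 1)) := hstable (n + 1) _ _ x _ h1
  have h3 : HasC1Bound (fun y => ∑' i, h (i + (n + 2)) y) x (∑' i, δ (i + (n + 2))) := by
    refine HasC1Bound.tsum ((summable_nat_add_iff (n + 2)).2 hδsum)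
      (fun i y hy => hball (i + (n + 2)) _ _ y ?_) hx'
    push_cast
    have : (0 : ℝ) ≤ i := i.cast_nonneg
    linarith
  refine (((h1.add h2).add h3).congr (Eventually.of_forall fun y => ?_)).mono ?_
  · have e := (hhs y).sum_add_tsum_nat_add (n + 2)
    rw [Finset.sum_range_succ, ← hS] at e
    simp only [← e]
    ring
  · have e1 : ∑' i, δ (i + (n + 2)) ≤ ∑' i, d (i + (n + 2)) :=
      ((summable_nat_add_iff (n + 2)).2 hδsum).tsum_le_tsum (fun i => hδd _)
        ((summable_nat_add_iff (n + 2)).2 hdsum)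
    have e2 := ((summable_nat_add_iff n).2 hdsum).sum_add_tsum_nat_add 2
    simp only [Finset.sum_range_succ, Finset.sum_range_zero, zero_add, add_assoc,
      add_comm 2 n, add_comm 1 n] at e2
    have := hδC n
    have := hδd (n + 1)
    have := hdtail n
    linarith

lemma enorm2_lt_of_norm_le {L : ℝ × ℝ →L[ℝ] ℝ} {c e : ℝ} (hL : ‖L‖ ≤ c) (he : 2 * c < e) :
    enorm2 (L (1, 0), L (0, 1)) < e := by
  have hc : 0 ≤ c := (norm_nonneg _).trans hL
  have h1 : |L (1, 0)| ≤ c := by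
    simpa using L.le_of_opNorm_le_of_le hL (show ‖((1 : ℝ), (0 : ℝ))‖ ≤ 1 by simp)
  have h2 : |L (0, 1)| ≤ c := by
    simpa using L.le_of_opNorm_le_of_le hL (show ‖((0 : ℝ), (1 : ℝ))‖ ≤ 1 by simp)
  rw [enorm2, Real.sqrt_lt' (by linarith)]
  have e1 := sq_le_sq' (abs_le.1 h1).1 (abs_le.1 h1).2
  have e2 := sq_le_sq' (abs_le.1 h2).1 (abs_le.1 h2).2
  simp only
  nlinarith

/-- Smooth functions on the plane can be approximated, together with their first
derivatives, by entire functions with an error decaying as fast as prescribed at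
infinity. -/
theorem statement14 (f : ℝ × ℝ → ℝ) (hf : ContDiff ℝ (⊤ : ℕ∞) f)
    (ε : ℝ × ℝ → ℝ) (hε : Continuous ε) (hpos : ∀ x, 0 < ε x) :
    ∃ F : ℝ × ℝ → ℝ, IsEntire F ∧
      (∀ x, |F x - f x| < ε x) ∧
      (∀ x, enorm2 (grad2 F x - grad2 f x) < ε x) := by
  obtain ⟨η, hanti, hη, hle⟩ := exists_antitone_lower_bound hε hpos
  obtain ⟨F, hF, hb⟩ := exists_entire_c1_approx hf hanti hη
  have hb' : ∀ x, ∃ c, HasC1Bound (fun y => F y - f y) x c ∧ 2 * c < ε x ∧ c < ε x := fun x => by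
    have h1 := Nat.lt_floor_add_one ‖x‖
    have h2 := hle ⌊‖x‖⌋₊ x h1.le
    have h3 := hη ⌊‖x‖⌋₊
    exact ⟨_, hb _ x (Nat.floor_le (norm_nonneg x)) h1, by linarith, by linarith⟩
  refine ⟨F, hF, fun x => ?_, fun x => ?_⟩
  · obtain ⟨c, ⟨_, _, h, _⟩, _, hc⟩ := hb' x
    exact h.trans_lt hc
  · obtain ⟨c, ⟨L, hL, _, h⟩, hc, _⟩ := hb' x
    have hfx := (hf.differentiable (by simp) x).hasFDerivAt
    have hFx : HasFDerivAt F (L + fderiv ℝ f x) x := by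
      simpa [Pi.add_def] using hL.add hfx
    have e : grad2 F x - grad2 f x = (L (1, 0), L (0, 1)) := by
      simp [grad2, hFx.fderiv]
    rw [e]
    exact enorm2_lt_of_norm_le h hc
end
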